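/- arXiv:1410.5804 — 2 statements merged into one kernel-verified Lean document; each statement's English description precedes it below -/
import Mathlib

section
/- There exist an integer r ≥ 2 and homomorphisms j, ρ : F_r → PSL(2,ℝ) from the free group F_r on r generators such that the action of F_r on PSL(2,ℝ) given by γ·x = ρ(γ) x j(γ)⁻¹ is properly discontinuous, but this action admits no fundamental domain bounded by pairwise disjoint left AdS crooked planes and no fundamental domain bounded by pairwise disjoint right AdS crooked planes. -/
noncomputable section

open Filter Topology Pointwise
open scoped UpperHalfPlane

/-- `SL(2,ℝ)`. -/
abbrev SL2 := Matrix.SpecialLinearGroup (Fin 2) ℝ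

instance : TopologicalSpace SL2 :=
  TopologicalSpace.induced (fun A : SL2 => (A : Matrix (Fin 2) (Fin 2) ℝ)) inferInstance

/-- `PSL(2,ℝ) = SL(2,ℝ)/{±I}`. -/
abbrev PSL2 := SL2 ⧸ Subgroup.center SL2

/-- The Möbius action of an element of `PSL(2,ℝ)` on the upper half-plane,
computed via an (arbitrary) lift to `SL(2,ℝ)`; this is well defined since
`-I` acts trivially. -/
def pslSMul (g : PSL2) (z : ℍ) : ℍ := (Quotient.out g) • z

/-- Image of a subset of `ℍ` under the Möbius action of `g ∈ PSL(2,ℝ)`. -/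
def pslImg (g : PSL2) (s : Set ℍ) : Set ℍ := pslSMul g '' s

/-- A geodesic line of `ℍ`: the image of an isometric embedding of `ℝ` into `ℍ`. -/
def IsGeodesicLine (l : Set ℍ) : Prop := ∃ γ : ℝ → ℍ, Isometry γ ∧ Set.range γ = l

/-- The embedding of `ℍ` into the one-point compactification of `ℂ`. -/
def embH (z : ℍ) : OnePoint ℂ := ((z : ℂ) : OnePoint ℂ)

/-- The embedding of `∂∞ℍ = ℝ ∪ {∞}` into the one-point compactification of `ℂ`. -/
def toC : OnePoint ℝ → OnePoint ℂ := OnePoint.map Complex.ofReal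

/-- The vector `v(ξ) ∈ ℝ²` associated with a boundary point `ξ ∈ ℝ ∪ {∞}`:
`v(ξ) = (ξ, 1)` for `ξ ∈ ℝ` and `v(∞) = (1, 0)`. -/
def bvec (ξ : OnePoint ℝ) : Fin 2 → ℝ := Option.elim ξ ![1, 0] (fun r => ![r, 1])

/-- The extended Möbius action of `PSL(2,ℝ)` on `∂∞ℍ = ℝ ∪ {∞}`. -/
def bdSMul (g : PSL2) (ξ : OnePoint ℝ) : OnePoint ℝ :=
  let w := ((Quotient.out g : SL2) : Matrix (Fin 2) (Fin 2) ℝ).mulVec (bvec ξ)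
  if w 1 = 0 then OnePoint.infty else ((w 0 / w 1 : ℝ) : OnePoint ℝ)

/-- `ξ ∈ ℝ ∪ {∞}` is an endpoint of the geodesic line `l`: some isometric
parametrization of `l` tends to `ξ` (in the one-point compactification of `ℂ`). -/
def IsEndpoint (l : Set ℍ) (ξ : OnePoint ℝ) : Prop :=
  ∃ γ : ℝ → ℍ, Isometry γ ∧ Set.range γ = l ∧
    Tendsto (fun t => embH (γ t)) atTop (𝓝 (toC ξ))

/-- `h ∈ PSL(2,ℝ)` has a nonattracting fixed point at `ξ ∈ ℝ ∪ {∞}`. -/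
def HasNonattracting (h : PSL2) (ξ : OnePoint ℝ) : Prop :=
  ∃ A : SL2, (QuotientGroup.mk A : PSL2) = h ∧
    ∃ μ : ℝ, |μ| ≤ 1 ∧ (A : Matrix (Fin 2) (Fin 2) ℝ).mulVec (bvec ξ) = μ • bvec ξ

/-- `h ∈ PSL(2,ℝ)` has a nonrepelling fixed point at `ξ ∈ ℝ ∪ {∞}`. -/
def HasNonrepelling (h : PSL2) (ξ : OnePoint ℝ) : Prop :=
  ∃ A : SL2, (QuotientGroup.mk A : PSL2) = h ∧
    ∃ μ : ℝ, 1 ≤ |μ| ∧ (A : Matrix (Fin 2) (Fin 2) ℝ).mulVec (bvec ξ) = μ • bvec ξ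

/-- The right AdS crooked plane `C*(l)` centered at the identity. -/
def rightCrooked (l : Set ℍ) : Set PSL2 :=
  {h | (∃ x ∈ l, pslSMul h x = x) ∨ ∃ ξ, IsEndpoint l ξ ∧ HasNonattracting h ξ}

/-- The left AdS crooked plane `C(l)` centered at the identity. -/
def leftCrooked (l : Set ℍ) : Set PSL2 :=
  {h | (∃ x ∈ l, pslSMul h x = x) ∨ ∃ ξ, IsEndpoint l ξ ∧ HasNonrepelling h ξ}

/-- A general right AdS crooked plane: a set of the form `g·C*(l)`. -/
def IsRightCrookedPlane (S : Set PSL2) : Prop :=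
  ∃ (g : PSL2) (l : Set ℍ), IsGeodesicLine l ∧ S = (g * ·) '' rightCrooked l

/-- A general left AdS crooked plane: a set of the form `C(l)·g`. -/
def IsLeftCrookedPlane (S : Set PSL2) : Prop :=
  ∃ (g : PSL2) (l : Set ℍ), IsGeodesicLine l ∧ S = (· * g) '' leftCrooked l

variable {Γ : Type*} [Group Γ]

/-- The action `γ·x = ρ(γ) x j(γ)⁻¹` of `Γ` on `PSL(2,ℝ)`, applied to a set. -/
def actImg (j ρ : Γ →* PSL2) (γ : Γ) (S : Set PSL2) : Set PSL2 :=
  (fun x => ρ γ * x * (j γ)⁻¹) '' S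

/-- The action `γ·x = ρ(γ) x j(γ)⁻¹` is properly discontinuous. -/
def ProperlyDisc (j ρ : Γ →* PSL2) : Prop :=
  ∀ K : Set PSL2, IsCompact K → {γ : Γ | (actImg j ρ γ K ∩ K).Nonempty}.Finite

/-- `R` is a fundamental domain for the action `γ·x = ρ(γ) x j(γ)⁻¹`:
`R` is closed, its translates cover `PSL(2,ℝ)`, and the interiors of the
translates are pairwise disjoint. -/
def IsFundDom (j ρ : Γ →* PSL2) (R : Set PSL2) : Prop :=
  IsClosed R ∧ (⋃ γ : Γ, actImg j ρ γ R) = Set.univ ∧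
    Pairwise fun γ₁ γ₂ : Γ =>
      Disjoint (interior (actImg j ρ γ₁ R)) (interior (actImg j ρ γ₂ R))

/-- The action admits a fundamental domain bounded by pairwise disjoint
right AdS crooked planes. -/
def AdmitsRightCrookedFD (j ρ : Γ →* PSL2) : Prop :=
  ∃ (m : ℕ) (D : Fin m → Set PSL2), (∀ i, IsRightCrookedPlane (D i)) ∧
    (∀ (γ γ' : Γ) (i i' : Fin m),
      actImg j ρ γ (D i) = actImg j ρ γ' (D i') ∨
      Disjoint (actImg j ρ γ (D i)) (actImg j ρ γ' (D i'))) ∧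
    ∃ x ∈ (⋃ (γ : Γ) (i : Fin m), actImg j ρ γ (D i))ᶜ,
      IsFundDom j ρ
        (closure (connectedComponentIn (⋃ (γ : Γ) (i : Fin m), actImg j ρ γ (D i))ᶜ x))

/-- The action admits a fundamental domain bounded by pairwise disjoint
left AdS crooked planes. -/
def AdmitsLeftCrookedFD (j ρ : Γ →* PSL2) : Prop :=
  ∃ (m : ℕ) (D : Fin m → Set PSL2), (∀ i, IsLeftCrookedPlane (D i)) ∧
    (∀ (γ γ' : Γ) (i i' : Fin m),
      actImg j ρ γ (D i) = actImg j ρ γ' (D i') ∨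
      Disjoint (actImg j ρ γ (D i)) (actImg j ρ γ' (D i'))) ∧
    ∃ x ∈ (⋃ (γ : Γ) (i : Fin m), actImg j ρ γ (D i))ᶜ,
      IsFundDom j ρ
        (closure (connectedComponentIn (⋃ (γ : Γ) (i : Fin m), actImg j ρ γ (D i))ᶜ x))

/-- The translation length `λ(g) = inf_{p ∈ ℍ} d(p, g·p)`. -/
def transLength (g : PSL2) : ℝ := ⨅ p : ℍ, dist p (pslSMul g p)

/-- `U` is a connected component of `S`. -/
def IsCC (S U : Set ℍ) : Prop := ∃ x ∈ S, connectedComponentIn S x = U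

/-- `ξ ∈ ℝ ∪ {∞}` is an ideal point of `U ⊆ ℍ`: a limit of a sequence of points
of `U` in the one-point compactification of `ℂ`. -/
def IsIdealPoint (U : Set ℍ) (ξ : OnePoint ℝ) : Prop :=
  ∃ u : ℕ → ℍ, (∀ n, u n ∈ U) ∧ Tendsto (fun n => embH (u n)) atTop (𝓝 (toC ξ))

/-- The closed right crooked half-space `H̄*₊(l, U)`. -/
def closedRHS (l U : Set ℍ) : Set PSL2 :=
  {h | (∃ x ∈ l ∪ U, pslSMul h x = x) ∨ ∃ ξ, IsIdealPoint U ξ ∧ HasNonattracting h ξ}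

/-- The open right crooked half-space `H*₊(l, U)`. -/
def openRHS (l U : Set ℍ) : Set PSL2 :=
  {h | h ≠ 1 ∧ ((∃ x ∈ U, pslSMul h x = x) ∨
    ∃ ξ, IsIdealPoint U ξ ∧ ¬ IsEndpoint l ξ ∧ HasNonattracting h ξ)}

/-- The circle of (Euclidean) radius `c` in `ℍ` centered at `0`; for suitable `c`
this is a geodesic line of `ℍ`. -/
def circ (c : ℝ) : Set ℍ := {z : ℍ | ‖(z : ℂ)‖ = c}

/-- The stem quadrant `SQ(ℓ)` for `ℓ = {|z| = 1/R}` transversely oriented towards `0`. -/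
def SQell (R : ℝ) : Set PSL2 :=
  {h | ∃ (A : SL2) (α β v : ℝ), (QuotientGroup.mk A : PSL2) = h ∧
    (A : Matrix (Fin 2) (Fin 2) ℝ) = !![α, -v/R; v*R, β] ∧
    |α| < |β| ∧ 2*|v| < |α - β|}

/-- The inverse stem quadrant `SQ(ℓ')⁻¹` for `ℓ' = {|z| = R}` transversely
oriented towards `∞`. -/
def SQell'inv (R : ℝ) : Set PSL2 :=
  {h | ∃ (A : SL2) (α β v : ℝ), (QuotientGroup.mk A : PSL2) = h ∧
    (A : Matrix (Fin 2) (Fin 2) ℝ) = !![α, v*R; -v/R, β] ∧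
    |α| < |β| ∧ 2*|v| < |α - β|}

/-- The stem quadrant `SQ(ℓ')`. -/
def SQell' (R : ℝ) : Set PSL2 := {h | h⁻¹ ∈ SQell'inv R}

/-- The matrix with given entries as an element of `SL2`. -/
def mk2 (a b c d : ℝ) (h : a * d - b * c = 1) : SL2 :=
  ⟨!![a, b; c, d], by rw [Matrix.det_fin_two_of]; exact h⟩

/-- The symplectic form on the plane. -/
def om (v w : Fin 2 → ℝ) : ℝ := v 0 * w 1 - v 1 * w 0

/-- The action of a matrix on vectors. -/
def ap (A : SL2) (v : Fin 2 → ℝ) : Fin 2 → ℝ := (A : Matrix (Fin 2) (Fin 2) ℝ).mulVec v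

lemma ap_zero (A : SL2) (v : Fin 2 → ℝ) : ap A v 0 = A.1 0 0 * v 0 + A.1 0 1 * v 1 := by
  simp [ap, Matrix.mulVec, dotProduct, Fin.sum_univ_two]

lemma ap_one (A : SL2) (v : Fin 2 → ℝ) : ap A v 1 = A.1 1 0 * v 0 + A.1 1 1 * v 1 := by
  simp [ap, Matrix.mulVec, dotProduct, Fin.sum_univ_two]

lemma ap_mul (A B : SL2) (v : Fin 2 → ℝ) : ap (A * B) v = ap A (ap B v) := by
  unfold ap
  rw [Matrix.mulVec_mulVec, Matrix.SpecialLinearGroup.coe_mul]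

lemma ap_neg (A : SL2) (v : Fin 2 → ℝ) : ap (-A) v = - ap A v := by
  simp [ap, Matrix.neg_mulVec]

lemma det_eq (A : SL2) : A.1 0 0 * A.1 1 1 - A.1 0 1 * A.1 1 0 = 1 := by
  have := A.2
  rwa [Matrix.det_fin_two] at this

lemma vec_ext {v w : Fin 2 → ℝ} (h0 : v 0 = w 0) (h1 : v 1 = w 1) : v = w := by
  ext i; fin_cases i <;> assumption

lemma sl_ext {A B : SL2} (h00 : A.1 0 0 = B.1 0 0) (h01 : A.1 0 1 = B.1 0 1)
    (h10 : A.1 1 0 = B.1 1 0) (h11 : A.1 1 1 = B.1 1 1) : A = B := by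
  apply Subtype.ext
  ext i j; fin_cases i <;> fin_cases j <;> assumption

lemma sl_ext_ap {A B : SL2} (h : ∀ v, ap A v = ap B v) : A = B := by
  have h1 := h ![1, 0]
  have h2 := h ![0, 1]
  apply sl_ext
  · simpa [ap_zero] using congrFun h1 0
  · simpa [ap_zero] using congrFun h2 0
  · simpa [ap_one] using congrFun h1 1
  · simpa [ap_one] using congrFun h2 1

lemma mem_center_sl (A : SL2) : A ∈ Subgroup.center SL2 ↔ A = 1 ∨ A = -1 := by
  rw [Matrix.SpecialLinearGroup.mem_center_iff]
  constructor
  · rintro ⟨r, hr, h⟩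
    have hr2 : r = 1 ∨ r = -1 := by
      rw [Fintype.card_fin] at hr
      rcases mul_eq_zero.mp (show (r - 1) * (r + 1) = 0 by linear_combination hr) with h' | h'
      · left; linarith
      · right; linarith
    rcases hr2 with rfl | rfl
    · left
      apply Subtype.ext
      rw [← h]; simp
    · right
      apply Subtype.ext
      rw [← h]
      ext i j; fin_cases i <;> fin_cases j <;> simp
  · rintro (rfl | rfl)
    · exact ⟨1, by simp, by simp⟩
    · refine ⟨-1, by simp, ?_⟩
      ext i j; fin_cases i <;> fin_cases j <;> simp

lemma mk_eq_iff (A B : SL2) : (QuotientGroup.mk A : PSL2) = QuotientGroup.mk B ↔ A = B ∨ A = -B := by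
  rw [QuotientGroup.eq, mem_center_sl]
  constructor
  · rintro (h | h)
    · left; exact inv_mul_eq_one.mp h
    · right
      have : B = A * (-1) := by rw [← h]; group
      rw [this]; simp
  · rintro (h | h)
    · left; rw [h]; simp
    · right; rw [h]; 
      have : (-B)⁻¹ = - B⁻¹ := by
        rw [inv_eq_iff_mul_eq_one]; simp
      rw [this]; simp

lemma out_cases (A : SL2) : Quotient.out (QuotientGroup.mk A : PSL2) = A ∨
    Quotient.out (QuotientGroup.mk A : PSL2) = -A := by
  rw [← mk_eq_iff]
  exact QuotientGroup.out_eq' _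

/-- Transvections. -/
def tv (n : ℝ) (e : Fin 2 → ℝ) : SL2 :=
  mk2 (1 - n * e 0 * e 1) (n * e 0 ^ 2) (-(n * e 1 ^ 2)) (1 + n * e 0 * e 1) (by ring)

lemma ap_tv (n : ℝ) (e v : Fin 2 → ℝ) : ap (tv n e) v = v + (n * om e v) • e := by
  apply vec_ext
  · rw [ap_zero]; simp [tv, mk2, om]; ring
  · rw [ap_one]; simp [tv, mk2, om]; ring

lemma om_ap (A : SL2) (v w : Fin 2 → ℝ) : om (ap A v) (ap A w) = om v w := by
  simp only [om, ap_zero, ap_one]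
  linear_combination (v 0 * w 1 - v 1 * w 0) * det_eq A

lemma conj_tv (A : SL2) (n : ℝ) (e : Fin 2 → ℝ) : A * tv n e * A⁻¹ = tv n (ap A e) := by
  rw [mul_inv_eq_iff_eq_mul]
  apply sl_ext_ap
  intro v
  rw [ap_mul, ap_mul, ap_tv, ap_tv, om_ap]
  apply vec_ext <;> simp [ap_zero, ap_one] <;> ring

lemma mul_00 (A B : SL2) : (A * B).1 0 0 = A.1 0 0 * B.1 0 0 + A.1 0 1 * B.1 1 0 := by
  rw [Matrix.SpecialLinearGroup.coe_mul, Matrix.mul_apply, Fin.sum_univ_two]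

lemma mul_11 (A B : SL2) : (A * B).1 1 1 = A.1 1 0 * B.1 0 1 + A.1 1 1 * B.1 1 1 := by
  rw [Matrix.SpecialLinearGroup.coe_mul, Matrix.mul_apply, Fin.sum_univ_two]

lemma tr_tv_mul (n t : ℝ) (e c : Fin 2 → ℝ) :
    (tv t c * tv n e).1 0 0 + (tv t c * tv n e).1 1 1 = 2 - n * t * om e c ^ 2 := by
  rw [mul_00, mul_11]; simp [tv, mk2, om]; ring

/-- Existence of the matrix realizing an intersection point. -/
lemma exists_meet (a c : Fin 2 → ℝ) (hs : om a c ≠ 0) (G : SL2) (h : om a (ap G c) ≠ 0) :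
    ∃ X : SL2, ap X a = a ∧ ap (X * G) c = (om a (ap G c) / om a c) • c := by
  set w := ap G c with hw
  set s := om a c with hs'
  set k := om a w with hk
  -- X v = (om v w / k) a + (om a v / s) c
  refine ⟨mk2 (w 1 / k * a 0 - a 1 / s * c 0) (- w 0 / k * a 0 + a 0 / s * c 0)
    (w 1 / k * a 1 - a 1 / s * c 1) (- w 0 / k * a 1 + a 0 / s * c 1) ?_, ?_, ?_⟩
  · have e1 : a 0 * w 1 - a 1 * w 0 = k := rfl
    have e2 : a 0 * c 1 - a 1 * c 0 = s := rfl
    field_simp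
    rw [← e1, ← e2]; ring
  · have e1 : a 0 * w 1 - a 1 * w 0 = k := rfl
    have e2 : a 0 * c 1 - a 1 * c 0 = s := rfl
    apply vec_ext
    · rw [ap_zero]; simp [mk2]; field_simp; rw [← e1]; ring
    · rw [ap_one]; simp [mk2]; field_simp; rw [← e1]; ring
  · rw [ap_mul, ← hw]
    have e1 : a 0 * w 1 - a 1 * w 0 = k := rfl
    have e2 : a 0 * c 1 - a 1 * c 0 = s := rfl
    apply vec_ext
    · rw [ap_zero]; simp [mk2]; field_simp; rw [← e1]; ring
    · rw [ap_one]; simp [mk2]; field_simp; rw [← e1]; ring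

lemma fix_cases (A : SL2) (x : ℍ) (h : A • x = x) :
    (A.1 0 0 + A.1 1 1) ^ 2 < 4 ∨ ∀ v, ∃ μ : ℝ, ap A v = μ • v := by
  have hx := UpperHalfPlane.coe_specialLinearGroup_apply A x
  rw [h] at hx
  have hy := x.im_pos
  have hne : ((algebraMap ℝ ℝ (A.1 1 0) : ℝ) : ℂ) * x + ((algebraMap ℝ ℝ (A.1 1 1) : ℝ) : ℂ) ≠ 0 := by
    intro h0
    have hi := congrArg Complex.im h0
    have hr := congrArg Complex.re h0
    simp at hi hr
    have : A.1 1 0 = 0 := by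
      rcases hi with hi | hi
      · exact hi
      · exact absurd hi hy.ne'
    rw [this] at hr
    simp at hr
    have := det_eq A
    simp_all
  rw [eq_div_iff hne] at hx
  have hi := congrArg Complex.im hx
  have hr := congrArg Complex.re hx
  simp at hi hr
  have hd := det_eq A
  have hv0 := fun v => ap_zero A v
  have hv1 := fun v => ap_one A v
  generalize A.1 0 0 = a at *
  generalize A.1 0 1 = b at *
  generalize A.1 1 0 = c at *
  generalize A.1 1 1 = d at *
  have e1 : 2 * c * x.re + d = a := by
    have : x.im * (2 * c * x.re + d - a) = 0 := by linear_combination hi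
    rcases mul_eq_zero.mp this with h' | h'
    · exact absurd h' hy.ne'
    · linarith
  have e2 : b = - c * (x.re ^ 2 + x.im ^ 2) := by
    linear_combination (-1) * hr + x.re * e1
  by_cases hc : c = 0
  · right
    intro v
    refine ⟨a, ?_⟩
    subst hc
    apply vec_ext
    · rw [hv0]; simp [e2]
    · rw [hv1]; simp [← e1]
  · left
    have : (a + d) ^ 2 = 4 - 4 * (c * x.im) ^ 2 := by
      subst e1; subst e2; linear_combination 4 * hd
    have : 0 < (c * x.im) ^ 2 := by positivity
    linarith

/-- The abstract properties of crooked planes that are used: `S` contains the unipotents fixing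
`a` or `c`, and contains no nonelliptic element fixing neither of the lines of `a` and `c`. -/
structure Crk (S : Set PSL2) (a c : Fin 2 → ℝ) : Prop where
  ne : om a c ≠ 0
  memA : ∀ A : SL2, ap A a = a → (QuotientGroup.mk A : PSL2) ∈ S
  memC : ∀ A : SL2, ap A c = c → (QuotientGroup.mk A : PSL2) ∈ S
  notMem : ∀ M : SL2, 4 ≤ (M.1 0 0 + M.1 1 1) ^ 2 → om a (ap M a) ≠ 0 → om c (ap M c) ≠ 0 →
    (QuotientGroup.mk M : PSL2) ∉ S

lemma om_self (v : Fin 2 → ℝ) : om v v = 0 := by simp [om]; ring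
lemma om_swap (v w : Fin 2 → ℝ) : om v w = - om w v := by simp [om]; ring
lemma om_add_smul (v w e : Fin 2 → ℝ) (k : ℝ) : om v (w + k • e) = om v w + k * om v e := by
  simp [om]; ring

lemma Crk.symm {S : Set PSL2} {a c : Fin 2 → ℝ} (h : Crk S a c) : Crk S c a :=
  ⟨by rw [om_swap]; exact neg_ne_zero.mpr h.ne, h.memC, h.memA,
    fun M h1 h2 h3 => h.notMem M h1 h3 h2⟩

lemma om_eq_zero_of {a c e : Fin 2 → ℝ} (h : om a c ≠ 0) (h1 : om e a = 0) (h2 : om e c = 0) :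
    e = 0 := by
  simp only [om] at *
  apply vec_ext
  · have : e 0 * (a 0 * c 1 - a 1 * c 0) = 0 := by
      linear_combination a 0 * h2 - c 0 * h1
    simpa [h] using this
  · have : e 1 * (a 0 * c 1 - a 1 * c 0) = 0 := by
      linear_combination a 1 * h2 - c 1 * h1
    simpa [h] using this

lemma ap_one' (v : Fin 2 → ℝ) : ap 1 v = v := by simp [ap]

lemma Crk.exists_not_aux {S : Set PSL2} {a c : Fin 2 → ℝ} (h : Crk S a c) (n : ℝ) (hn : n ≠ 0)
    (e : Fin 2 → ℝ) (he : e ≠ 0) (hea : om e a = 0) :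
    ∃ H : SL2, (QuotientGroup.mk H : PSL2) ∈ S ∧ (QuotientGroup.mk (H * tv n e) : PSL2) ∉ S := by
  have hec : om e c ≠ 0 := fun h2 => he (om_eq_zero_of h.ne hea h2)
  refine ⟨tv (-n) c, h.memC _ ?_, h.notMem _ ?_ ?_ ?_⟩
  · rw [ap_tv, om_self]; simp
  · rw [tr_tv_mul]
    have : 0 < n ^ 2 * om e c ^ 2 := by positivity
    nlinarith
  · rw [ap_mul, ap_tv n e, hea]
    simp only [mul_zero, zero_smul, add_zero]
    rw [ap_tv, om_add_smul, om_self, om_swap c a]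
    have := h.ne
    simp [this, hn]
  · rw [ap_mul, ap_tv n e, ap_tv, om_add_smul, om_add_smul, om_self, om_swap c e]
    simp [hec, hn]

lemma Crk.exists_not {S : Set PSL2} {a c : Fin 2 → ℝ} (h : Crk S a c) (n : ℝ) (hn : n ≠ 0)
    (e : Fin 2 → ℝ) (he : e ≠ 0) :
    ∃ H : SL2, (QuotientGroup.mk H : PSL2) ∈ S ∧ (QuotientGroup.mk (H * tv n e) : PSL2) ∉ S := by
  by_cases hea : om e a = 0
  · exact h.exists_not_aux n hn e he hea
  by_cases hec : om e c = 0
  · exact h.symm.exists_not_aux n hn e he hec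
  refine ⟨1, h.memA _ (ap_one' _), h.notMem _ ?_ ?_ ?_⟩
  · rw [one_mul]; simp [tv, mk2]; norm_num
  · rw [one_mul, ap_tv, om_add_smul, om_self, om_swap a e]; simp [hea, hn]
  · rw [one_mul, ap_tv, om_add_smul, om_self, om_swap c e]; simp [hec, hn]

lemma om_bvec {ξ η : OnePoint ℝ} (h : ξ ≠ η) : om (bvec ξ) (bvec η) ≠ 0 := by
  induction ξ using OnePoint.rec <;> induction η using OnePoint.rec
  · exact absurd rfl h
  · change om ![1, 0] ![_, 1] ≠ 0; simp [om]
  · change om ![_, 1] ![1, 0] ≠ 0; simp [om]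
  · change om ![_, 1] ![_, 1] ≠ 0; simp [om]
    intro hd
    apply h
    rw [sub_eq_zero.mp hd]

/-- `ξ` and `η` are exactly the endpoints of `l`. -/
structure Ends (l : Set ℍ) (ξ η : OnePoint ℝ) : Prop where
  ne : ξ ≠ η
  left : IsEndpoint l ξ
  right : IsEndpoint l η
  only : ∀ ζ, IsEndpoint l ζ → ζ = ξ ∨ ζ = η

lemma sl_neg_smul' (M : SL2) (x : ℍ) : (-M) • x = M • x := by
  apply UpperHalfPlane.ext
  rw [UpperHalfPlane.coe_specialLinearGroup_apply, UpperHalfPlane.coe_specialLinearGroup_apply]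
  rw [← neg_div_neg_eq]
  congr 1 <;> simp <;> ring

lemma notMem_aux {l : Set ℍ} {ξ η : OnePoint ℝ} (h : Ends l ξ η) (M : SL2)
    (h1 : 4 ≤ (M.1 0 0 + M.1 1 1) ^ 2) (h2 : om (bvec ξ) (ap M (bvec ξ)) ≠ 0)
    (h3 : om (bvec η) (ap M (bvec η)) ≠ 0) :
    (¬ ∃ x ∈ l, pslSMul (QuotientGroup.mk M) x = x) ∧
    ¬ ∃ ζ, IsEndpoint l ζ ∧ ∃ A : SL2, (QuotientGroup.mk A : PSL2) = QuotientGroup.mk M ∧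
      ∃ μ : ℝ, ap A (bvec ζ) = μ • bvec ζ := by
  constructor
  · rintro ⟨x, -, hx⟩
    have hx' : M • x = x := by
      unfold pslSMul at hx
      rcases out_cases M with h | h
      · rwa [h] at hx
      · rwa [h, sl_neg_smul'] at hx
    rcases fix_cases M x hx' with h | h
    · linarith
    · obtain ⟨μ, hμ⟩ := h (bvec ξ)
      apply h2
      rw [hμ]; simp [om]; ring
  · rintro ⟨ζ, hζ, A, hA, μ, hμ⟩
    have key : om (bvec ζ) (ap M (bvec ζ)) = 0 := by
      rw [mk_eq_iff] at hA
      rcases hA with rfl | rfl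
      · rw [hμ]; simp [om]; ring
      · rw [ap_neg] at hμ
        rw [neg_eq_iff_eq_neg.mp hμ]; simp [om]; ring
    rcases h.only ζ hζ with rfl | rfl
    · exact h2 key
    · exact h3 key

lemma left_crk {l : Set ℍ} {ξ η : OnePoint ℝ} (h : Ends l ξ η) :
    Crk (leftCrooked l) (bvec ξ) (bvec η) where
  ne := om_bvec h.ne
  memA A hA := Or.inr ⟨ξ, h.left, A, rfl, 1, by simp, by rw [one_smul]; exact hA⟩
  memC A hA := Or.inr ⟨η, h.right, A, rfl, 1, by simp, by rw [one_smul]; exact hA⟩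
  notMem M h1 h2 h3 := by
    obtain ⟨k1, k2⟩ := notMem_aux h M h1 h2 h3
    rintro (h | ⟨ζ, hζ, A, hA, μ, -, hμ⟩)
    · exact k1 h
    · exact k2 ⟨ζ, hζ, A, hA, μ, hμ⟩

lemma right_crk {l : Set ℍ} {ξ η : OnePoint ℝ} (h : Ends l ξ η) :
    Crk (rightCrooked l) (bvec ξ) (bvec η) where
  ne := om_bvec h.ne
  memA A hA := Or.inr ⟨ξ, h.left, A, rfl, 1, by simp, by rw [one_smul]; exact hA⟩
  memC A hA := Or.inr ⟨η, h.right, A, rfl, 1, by simp, by rw [one_smul]; exact hA⟩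
  notMem M h1 h2 h3 := by
    obtain ⟨k1, k2⟩ := notMem_aux h M h1 h2 h3
    rintro (h | ⟨ζ, hζ, A, hA, μ, -, hμ⟩)
    · exact k1 h
    · exact k2 ⟨ζ, hζ, A, hA, μ, hμ⟩

/-- Dirichlet approximation yields a suitable integral transvection. -/
lemma exists_int_tv {ξ η : OnePoint ℝ} (h : ξ ≠ η) :
    ∃ (k p q : ℤ), k ≠ 0 ∧ (p ≠ 0 ∨ q ≠ 0) ∧
      let e : Fin 2 → ℝ := ![(p : ℝ), (q : ℝ)]
      let κ := om (bvec ξ) (ap (tv (2 * k) e) (bvec η))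
      κ ≠ 0 ∧ |κ| ≤ |om (bvec ξ) (bvec η)| := by
  have hs := om_bvec h
  suffices H : ∃ p q : ℤ, (p ≠ 0 ∨ q ≠ 0) ∧
      |om ![(p : ℝ), (q : ℝ)] (bvec η) * om (bvec ξ) ![(p : ℝ), (q : ℝ)]| ≤
        |om (bvec ξ) (bvec η)| by
    obtain ⟨p, q, hpq, H⟩ := H
    have red : ∀ k : ℤ, k ≠ 0 →
        (om (bvec ξ) (bvec η) + 2 * k *
          (om ![(p : ℝ), (q : ℝ)] (bvec η) * om (bvec ξ) ![(p : ℝ), (q : ℝ)]) ≠ 0 ∧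
        |om (bvec ξ) (bvec η) + 2 * k *
          (om ![(p : ℝ), (q : ℝ)] (bvec η) * om (bvec ξ) ![(p : ℝ), (q : ℝ)])| ≤
          |om (bvec ξ) (bvec η)|) →
        ∃ (k p q : ℤ), k ≠ 0 ∧ (p ≠ 0 ∨ q ≠ 0) ∧
      let e : Fin 2 → ℝ := ![(p : ℝ), (q : ℝ)]
      let κ := om (bvec ξ) (ap (tv (2 * k) e) (bvec η))
      κ ≠ 0 ∧ |κ| ≤ |om (bvec ξ) (bvec η)| := by
      intro k hk hh
      refine ⟨k, p, q, hk, hpq, ?_⟩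
      intro e κ
      have : κ = om (bvec ξ) (bvec η) + 2 * k *
          (om ![(p : ℝ), (q : ℝ)] (bvec η) * om (bvec ξ) ![(p : ℝ), (q : ℝ)]) := by
        simp only [κ]
        rw [ap_tv, om_add_smul]; ring
      rw [this]
      exact hh
    generalize om (bvec ξ) (bvec η) = s at *
    generalize om ![(p : ℝ), (q : ℝ)] (bvec η) * om (bvec ξ) ![(p : ℝ), (q : ℝ)] = Q at *
    have fin : ∀ k : ℤ, k ≠ 0 → (s + 2 * k * Q ≠ 0) → 
      ((s + 2 * k * Q) ^ 2 ≤ s ^ 2) → ∃ k : ℤ, k ≠ 0 ∧ (s + 2 * k * Q ≠ 0 ∧ |s + 2 * k * Q| ≤ |s|) :=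
      fun k h1 h2 h3 => ⟨k, h1, h2, sq_le_sq.mp h3⟩
    have : ∃ k : ℤ, k ≠ 0 ∧ (s + 2 * k * Q ≠ 0 ∧ |s + 2 * k * Q| ≤ |s|) := by
      have H2 : Q ^ 2 ≤ s ^ 2 := sq_le_sq.mpr H
      have hA : |s * Q| ≤ s ^ 2 := by
        rw [abs_mul, ← sq_abs s, sq]
        exact mul_le_mul_of_nonneg_left H (abs_nonneg _)
      have hQ : Q ^ 2 ≤ |s * Q| := by
        rw [abs_mul, ← sq_abs Q, sq]
        exact mul_le_mul_of_nonneg_right H (abs_nonneg _)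
      by_cases c1 : s = 2 * Q
      · refine fin (-2) (by norm_num) ?_ ?_
        · push_cast; intro h0; apply hs; linarith
        · push_cast; rw [c1]; apply le_of_eq; ring
      by_cases c2 : s = -(2 * Q)
      · refine fin 2 (by norm_num) ?_ ?_
        · push_cast; intro h0; apply hs; linarith
        · push_cast; rw [c2]; apply le_of_eq; ring
      rcases le_total 0 (s * Q) with c | c
      · rw [abs_of_nonneg c] at hQ
        refine fin (-1) (by norm_num) ?_ ?_
        · push_cast; intro h0; apply c1; linarith
        · push_cast; nlinarith
      · rw [abs_of_nonpos c] at hQ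
        refine fin 1 (by norm_num) ?_ ?_
        · push_cast; intro h0; apply c2; linarith
        · push_cast; nlinarith
    obtain ⟨k, hk, hh⟩ := this
    exact red k hk hh
  induction ξ using OnePoint.rec with
  | infty =>
    refine ⟨1, 0, by simp, ?_⟩
    have : om (bvec OnePoint.infty) ![((1 : ℤ) : ℝ), ((0 : ℤ) : ℝ)] = 0 := by
      change om ![1, 0] _ = 0; simp [om]
    rw [this]; simp
  | coe α =>
  induction η using OnePoint.rec with
  | infty =>
    refine ⟨1, 0, by simp, ?_⟩
    have : om ![((1 : ℤ) : ℝ), ((0 : ℤ) : ℝ)] (bvec OnePoint.infty) = 0 := by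
      change om _ ![1, 0] = 0; simp [om]
    rw [this]; simp
  | coe β =>
    have ea : bvec (α : OnePoint ℝ) = ![α, 1] := rfl
    have eb : bvec (β : OnePoint ℝ) = ![β, 1] := rfl
    rw [ea, eb] at hs ⊢
    simp [om] at hs ⊢
    have hs' : 0 < |α - β| := abs_pos.mpr hs
    obtain ⟨n, hn⟩ := exists_nat_one_div_lt hs'
    obtain ⟨p, q, hq, hqn, hd⟩ := Real.exists_int_int_abs_mul_sub_le α (Nat.succ_pos n)
    refine ⟨p, q, Or.inr hq.ne', ?_⟩
    have hn1 : (0 : ℝ) < n + 1 := by positivity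
    set δ := |(q : ℝ) * α - p| with hδ
    have d1 : |α * q - p| = δ := by rw [hδ]; congr 1; ring
    have hq0 : (0 : ℝ) < q := by exact_mod_cast hq
    have hqn' : (q : ℝ) ≤ n + 1 := by exact_mod_cast hqn
    have d2 : |(p : ℝ) - q * β| ≤ δ + q * |α - β| := by
      calc |(p : ℝ) - q * β| = |(-(q * α - p)) + q * (α - β)| := by congr 1; ring
        _ ≤ |(-(q * α - p))| + |q * (α - β)| := abs_add_le _ _
        _ = _ := by rw [abs_neg, abs_mul, abs_of_pos hq0]
    have d0 : 0 ≤ δ := abs_nonneg _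
    rw [d1]
    push_cast at hd
    have hd' : δ * (n + 1 + 1) ≤ 1 := by
      rw [le_div_iff₀ (by positivity)] at hd; exact hd
    have hn' : δ ≤ |α - β| := by
      refine hd.trans (le_trans ?_ hn.le)
      exact one_div_le_one_div_of_le hn1 (by linarith)
    calc |(p : ℝ) - q * β| * δ ≤ (δ + q * |α - β|) * δ := mul_le_mul_of_nonneg_right d2 d0
      _ ≤ (|α - β| + (n + 1) * |α - β|) * δ := by
        apply mul_le_mul_of_nonneg_right _ d0
        have := mul_le_mul_of_nonneg_right hqn' hs'.le
        linarith
      _ = |α - β| * (δ * (n + 1 + 1)) := by ring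
      _ ≤ |α - β| * 1 := mul_le_mul_of_nonneg_left hd' hs'.le
      _ = _ := mul_one _

/-- The boundary point with homogeneous coordinates `(x, y)`. -/
def bpt (x y : ℝ) : OnePoint ℝ := if y = 0 then OnePoint.infty else ((x / y : ℝ) : OnePoint ℝ)

lemma bpt_ne (G : SL2) : bpt (G.1 0 0) (G.1 1 0) ≠ bpt (G.1 0 1) (G.1 1 1) := by
  have h := det_eq G
  generalize G.1 0 0 = a at *
  generalize G.1 0 1 = b at *
  generalize G.1 1 0 = c at *
  generalize G.1 1 1 = d at *
  unfold bpt
  split_ifs with h1 h2 h2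
  · simp [h1, h2] at h
  · exact (OnePoint.coe_ne_infty _).symm
  · exact OnePoint.coe_ne_infty _
  · intro h3
    have h4 := OnePoint.coe_injective h3
    rw [div_eq_div_iff h1 h2] at h4
    linarith

lemma tendsto_top (G : SL2) (f : ℝ → ℍ) (F : Filter ℝ) (hre : ∀ t, (f t).re = 0)
    (him : Tendsto (fun t => (f t).im) F atTop) :
    Tendsto (fun t => embH (G • f t)) F (𝓝 (toC (bpt (G.1 0 0) (G.1 1 0)))) := by
  have hd := det_eq G
  have hv : ∀ t, ((G • f t : ℍ) : ℂ) =
      ((G.1 0 0 : ℝ) * (f t : ℂ) + (G.1 0 1 : ℝ)) / ((G.1 1 0 : ℝ) * (f t : ℂ) + (G.1 1 1 : ℝ)) := by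
    intro t
    rw [UpperHalfPlane.coe_specialLinearGroup_apply]; rfl
  unfold embH
  simp only [hv]
  clear hv
  generalize G.1 0 0 = a at *
  generalize G.1 0 1 = b at *
  generalize G.1 1 0 = c at *
  generalize G.1 1 1 = d at *
  unfold bpt
  split_ifs with hc
  · subst hc
    have hd0 : d ≠ 0 := by rintro rfl; simp at hd
    have ha0 : a ≠ 0 := by rintro rfl; simp at hd
    have : toC OnePoint.infty = OnePoint.infty := rfl
    rw [this]
    refine OnePoint.tendsto_coe_infty.comp ?_
    rw [Filter.coclosedCompact_eq_cocompact, ← Metric.cobounded_eq_cocompact,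
      ← tendsto_norm_atTop_iff_cobounded]
    have h1 : Tendsto (fun t => |a / d| * (f t).im) F atTop :=
      him.const_mul_atTop (abs_pos.mpr (div_ne_zero ha0 hd0))
    refine tendsto_atTop_mono (fun t => ?_) h1
    refine le_trans (le_of_eq ?_) (Complex.abs_im_le_norm _)
    have e : ((a : ℂ) * (f t : ℂ) + b) / (((0 : ℝ) : ℂ) * (f t : ℂ) + d) =
      ((a / d : ℝ) : ℂ) * (f t : ℂ) + ((b / d : ℝ) : ℂ) := by
      have : (d : ℂ) ≠ 0 := by exact_mod_cast hd0
      push_cast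
      rw [zero_mul, zero_add]
      field_simp
    rw [e]
    simp [abs_mul, abs_of_pos (f t).im_pos]
  · have : toC ((a / c : ℝ) : OnePoint ℝ) = (((a / c : ℝ) : ℂ) : OnePoint ℂ) := rfl
    rw [this]
    refine (OnePoint.continuous_coe.tendsto _).comp ?_
    rw [tendsto_iff_norm_sub_tendsto_zero]
    have h1 : Tendsto (fun t => (c ^ 2 * (f t).im)⁻¹) F (𝓝 0) :=
      (him.const_mul_atTop (by positivity)).inv_tendsto_atTop
    refine squeeze_zero (fun t => norm_nonneg _) (fun t => ?_) h1
    have hy := (f t).im_pos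
    have hn : |c| * (f t).im ≤ ‖(c : ℂ) * (f t : ℂ) + d‖ := by
      refine le_trans (le_of_eq ?_) (Complex.abs_im_le_norm _)
      simp [abs_mul, abs_of_pos hy]
    have hc' : 0 < |c| := abs_pos.mpr hc
    have hn0 : 0 < ‖(c : ℂ) * (f t : ℂ) + d‖ := lt_of_lt_of_le (by positivity) hn
    have hne : (c : ℂ) * (f t : ℂ) + d ≠ 0 := norm_pos_iff.mp hn0
    have hcc : (c : ℂ) ≠ 0 := by exact_mod_cast hc
    have e : ((a : ℂ) * (f t : ℂ) + b) / ((c : ℂ) * (f t : ℂ) + d) - ((a / c : ℝ) : ℂ) =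
      - ((c : ℂ) * ((c : ℂ) * (f t : ℂ) + d))⁻¹ := by
      have hd' : (a : ℂ) * d - b * c = 1 := by exact_mod_cast hd
      generalize ((f t : ℍ) : ℂ) = z at *
      push_cast
      rw [div_sub_div _ _ hne hcc, eq_neg_iff_add_eq_zero, inv_eq_one_div,
        div_add_div _ _ (mul_ne_zero hne hcc) (mul_ne_zero hcc hne), div_eq_zero_iff]
      left
      linear_combination (-(c : ℂ) * ((c : ℂ) * z + d)) * hd'
    rw [e, norm_neg, norm_inv, norm_mul, Complex.norm_real, Real.norm_eq_abs]
    apply inv_anti₀ (by positivity)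
    calc c ^ 2 * (f t).im = |c| * (|c| * (f t).im) := by rw [← sq_abs c]; ring
      _ ≤ _ := mul_le_mul_of_nonneg_left hn hc'.le

lemma tendsto_bot (G : SL2) (f : ℝ → ℍ) (F : Filter ℝ) (hre : ∀ t, (f t).re = 0)
    (him : Tendsto (fun t => ((f t).im)⁻¹) F atTop) :
    Tendsto (fun t => embH (G • f t)) F (𝓝 (toC (bpt (G.1 0 1) (G.1 1 1)))) := by
  let J : SL2 := mk2 0 (-1) 1 0 (by norm_num)
  have hJ : J⁻¹ = mk2 0 1 (-1) 0 (by norm_num) := by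
    rw [inv_eq_iff_mul_eq_one]
    apply Subtype.ext
    rw [Matrix.SpecialLinearGroup.coe_mul]
    simp [J, mk2, Matrix.one_fin_two]
  have hz : ∀ t, ((J⁻¹ • f t : ℍ) : ℂ) = ⟨0, (f t).im⁻¹⟩ := by
    intro t
    have hy := (f t).im_pos
    rw [hJ, UpperHalfPlane.coe_specialLinearGroup_apply]
    have hf : ((f t : ℍ) : ℂ) = ⟨0, (f t).im⟩ := by
      apply Complex.ext
      · simpa using hre t
      · simp
    rw [hf]
    generalize (f t).im = y at *
    have e : (⟨0, y⟩ : ℂ) ≠ 0 := by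
      intro h; have := congrArg Complex.im h; simp at this; linarith
    have e2 : (⟨0, y⁻¹⟩ : ℂ) * ⟨0, y⟩ = -1 := by
      apply Complex.ext <;> simp [hy.ne']
    simp [mk2]
    rw [neg_eq_iff_eq_neg]
    rw [inv_eq_iff_eq_inv]
    apply eq_inv_of_mul_eq_one_left
    linear_combination (-1) * e2
  have h := tendsto_top (G * J) (fun t => J⁻¹ • f t) F (fun t => ?_) ?_
  · have e0 : (G * J).1 0 0 = G.1 0 1 := by rw [mul_00]; simp [J, mk2]
    have e1 : (G * J).1 1 0 = G.1 1 1 := by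
      rw [Matrix.SpecialLinearGroup.coe_mul, Matrix.mul_apply, Fin.sum_univ_two]; simp [J, mk2]
    rw [e0, e1] at h
    refine h.congr fun t => ?_
    rw [smul_smul]; congr 2; group
  · rw [← UpperHalfPlane.coe_re, hz]
  · refine him.congr fun t => ?_
    exact (congrArg Complex.im (hz t)).symm

/-- Two points can be moved to the imaginary axis. -/
lemma exists_axis (z w : ℍ) : ∃ G : SL2, (G • z).re = 0 ∧ (G • w).re = 0 := by
  have form : ∀ (G : SL2) (z : ℍ), (G • z).re = 0 ↔
      (G.1 0 0 * z.re + G.1 0 1) * (G.1 1 0 * z.re + G.1 1 1) + G.1 0 0 * G.1 1 0 * z.im ^ 2 = 0 := by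
    intro G z
    have hne : (G.1 1 0 * z.re + G.1 1 1) ^ 2 + (G.1 1 0 * z.im) ^ 2 ≠ 0 := by
      intro h
      have hy := z.im_pos
      have h1 : G.1 1 0 * z.im = 0 := by nlinarith [sq_nonneg (G.1 1 0 * z.re + G.1 1 1), sq_nonneg (G.1 1 0 * z.im)]
      have h2 : G.1 1 0 = 0 := by simpa [hy.ne'] using h1
      rw [h2] at h
      have h3 : G.1 1 1 = 0 := by simpa using h
      have := det_eq G
      simp [h2, h3] at this
    rw [← UpperHalfPlane.coe_re, UpperHalfPlane.coe_specialLinearGroup_apply]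
    simp only [Complex.div_re, Complex.normSq]
    simp
    rw [← add_div, div_eq_zero_iff]
    constructor
    · rintro (h | h)
      · linear_combination h
      · exfalso; apply hne; linear_combination h
    · intro h; left; linear_combination h
  by_cases h : z.re = w.re
  · refine ⟨mk2 1 (-z.re) 0 1 (by norm_num), ?_, ?_⟩ <;> rw [form] <;> simp [mk2, h]
  · have h' : z.re - w.re ≠ 0 := sub_ne_zero.mpr h
    obtain ⟨m, hm'⟩ : ∃ m : ℝ, 2 * m * (z.re - w.re) =
        (z.re ^ 2 + z.im ^ 2) - (w.re ^ 2 + w.im ^ 2) :=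
      ⟨((z.re ^ 2 + z.im ^ 2) - (w.re ^ 2 + w.im ^ 2)) / (2 * (z.re - w.re)), by field_simp⟩
    set r := √((z.re - m) ^ 2 + z.im ^ 2) with hr
    have hpos : 0 < (z.re - m) ^ 2 + z.im ^ 2 := by have := z.im_pos; positivity
    have hr0 : 0 < r := Real.sqrt_pos.mpr hpos
    have hr2 : r ^ 2 = (z.re - m) ^ 2 + z.im ^ 2 := Real.sq_sqrt hpos.le
    refine ⟨mk2 (1 / (2 * r)) (-(m - r) / (2 * r)) (-1) (m + r) (by field_simp; ring), ?_, ?_⟩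
    · rw [form]; simp [mk2]; field_simp; linear_combination hr2
    · rw [form]; simp [mk2]; field_simp; linear_combination hr2 - hm'

lemma geod_axis (f : ℝ → ℍ) (hf : Isometry f) (h0 : (f 0).re = 0) (h1 : (f 1).re = 0) :
    ∃ s ε : ℝ, 0 < s ∧ (ε = 1 ∨ ε = -1) ∧ ∀ t, (f t).re = 0 ∧ (f t).im = s * Real.exp (ε * t) := by
  have hy0 := (f 0).im_pos
  have hy1 := (f 1).im_pos
  have hd : |Real.log (f 1).im - Real.log (f 0).im| = 1 := by
    have := UpperHalfPlane.dist_of_re_eq (h1.trans h0.symm)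
    rw [hf.dist_eq, Real.dist_eq, Real.dist_eq] at this
    rw [← this]; norm_num
  obtain ⟨ε, hε, hl⟩ : ∃ ε : ℝ, (ε = 1 ∨ ε = -1) ∧
      Real.log (f 1).im = Real.log (f 0).im + ε := by
    rcases (abs_eq zero_le_one).mp hd with h | h
    · exact ⟨1, Or.inl rfl, by linarith⟩
    · exact ⟨-1, Or.inr rfl, by linarith⟩
  have hεabs : |ε| = 1 := by rcases hε with rfl | rfl <;> simp
  refine ⟨(f 0).im, ε, hy0, hε, fun t => ?_⟩
  set T : ℍ := UpperHalfPlane.mk ⟨0, (f 0).im * Real.exp (ε * t)⟩ (by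
    show 0 < (f 0).im * Real.exp (ε * t); positivity)
  have hTre : T.re = 0 := rfl
  have hTim : T.im = (f 0).im * Real.exp (ε * t) := rfl
  have hlogT : Real.log T.im = Real.log (f 0).im + ε * t := by
    rw [hTim, Real.log_mul hy0.ne' (Real.exp_pos _).ne', Real.log_exp]
  have d0 : dist T (f 0) = dist (f t) (f 0) := by
    rw [UpperHalfPlane.dist_of_re_eq (hTre.trans h0.symm), hf.dist_eq, hlogT, Real.dist_eq,
      Real.dist_eq]
    rw [add_sub_cancel_left, abs_mul, hεabs]; simp
  have d1 : dist T (f 1) = dist (f t) (f 1) := by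
    rw [UpperHalfPlane.dist_of_re_eq (hTre.trans h1.symm), hf.dist_eq, hlogT, hl, Real.dist_eq,
      Real.dist_eq]
    rw [show Real.log (f 0).im + ε * t - (Real.log (f 0).im + ε) = ε * (t - 1) by ring, abs_mul,
      hεabs, one_mul]
  have c0 := congrArg Real.cosh d0
  have c1 := congrArg Real.cosh d1
  rw [UpperHalfPlane.cosh_dist', UpperHalfPlane.cosh_dist'] at c0 c1
  have hne : (f 0).im ≠ (f 1).im := by
    intro h; rw [← h] at hd; simp at hd
  have hTpos := T.im_pos
  have hfpos := (f t).im_pos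
  rw [h0, hTre] at c0
  rw [h1, hTre] at c1
  rw [← hTim]
  clear d0 d1 hlogT hTre hTim
  clear_value T
  generalize T.im = Y at *
  generalize (f t).im = y at *
  generalize (f t).re = x at *
  generalize (f 0).im = y0 at *
  generalize (f 1).im = y1 at *
  rw [div_eq_div_iff (by positivity) (by positivity)] at c0 c1
  have k0 : (Y ^ 2 + y0 ^ 2) * y = (x ^ 2 + y ^ 2 + y0 ^ 2) * Y := by
    have : (2 * y0) * ((Y ^ 2 + y0 ^ 2) * y - (x ^ 2 + y ^ 2 + y0 ^ 2) * Y) = 0 := by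
      linear_combination c0
    rcases mul_eq_zero.mp this with h | h
    · linarith
    · linarith
  have k1 : (Y ^ 2 + y1 ^ 2) * y = (x ^ 2 + y ^ 2 + y1 ^ 2) * Y := by
    have : (2 * y1) * ((Y ^ 2 + y1 ^ 2) * y - (x ^ 2 + y ^ 2 + y1 ^ 2) * Y) = 0 := by
      linear_combination c1
    rcases mul_eq_zero.mp this with h | h
    · linarith
    · linarith
  have k2 : (y0 - y1) * ((y0 + y1) * (y - Y)) = 0 := by linear_combination k0 - k1
  have k3 : y = Y := by
    rcases mul_eq_zero.mp k2 with h | h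
    · exact absurd (sub_eq_zero.mp h) hne
    · rcases mul_eq_zero.mp h with h | h
      · linarith
      · linarith
  refine ⟨?_, k3⟩
  rw [k3] at k0
  have : x ^ 2 * Y = 0 := by linear_combination (-1) * k0
  simpa [hTpos.ne'] using this

lemma exists_param (l : Set ℍ) (hl : IsGeodesicLine l) : ∃ (γ : ℝ → ℍ) (ξ η : OnePoint ℝ),
    ξ ≠ η ∧ Isometry γ ∧ Set.range γ = l ∧ Tendsto (fun t => embH (γ t)) atTop (𝓝 (toC ξ)) ∧
      Tendsto (fun t => embH (γ (-t))) atTop (𝓝 (toC η)) := by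
  obtain ⟨γ, hγ, hr⟩ := hl
  obtain ⟨G, hG0, hG1⟩ := exists_axis (γ 0) (γ 1)
  have hf : Isometry (fun t => G • γ t) := (isometry_smul ℍ G).comp hγ
  obtain ⟨s, ε, hs, hε, hform⟩ := geod_axis _ hf hG0 hG1
  have hback : ∀ t, γ t = G⁻¹ • (G • γ t) := fun t => by rw [inv_smul_smul]
  rcases hε with rfl | rfl
  · refine ⟨γ, _, _, bpt_ne G⁻¹, hγ, hr, ?_, ?_⟩
    · have := tendsto_top G⁻¹ (fun t => G • γ t) atTop (fun t => (hform t).1) (by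
        simp only [(hform _).2, one_mul]
        exact Real.tendsto_exp_atTop.const_mul_atTop hs)
      simpa only [inv_smul_smul] using this
    · have := tendsto_bot G⁻¹ (fun t => G • γ (-t)) atTop (fun t => (hform (-t)).1) (by
        simp only [(hform _).2, one_mul, mul_inv, Real.exp_neg, inv_inv]
        exact Real.tendsto_exp_atTop.const_mul_atTop (inv_pos.mpr hs))
      simpa only [inv_smul_smul] using this
  · refine ⟨γ, _, _, (bpt_ne G⁻¹).symm, hγ, hr, ?_, ?_⟩
    · have := tendsto_bot G⁻¹ (fun t => G • γ t) atTop (fun t => (hform t).1) (by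
        simp only [(hform _).2, neg_mul, one_mul, mul_inv, Real.exp_neg, inv_inv]
        exact Real.tendsto_exp_atTop.const_mul_atTop (inv_pos.mpr hs))
      simpa only [inv_smul_smul] using this
    · have := tendsto_top G⁻¹ (fun t => G • γ (-t)) atTop (fun t => (hform (-t)).1) (by
        simp only [(hform _).2, neg_mul, one_mul, neg_neg]
        exact Real.tendsto_exp_atTop.const_mul_atTop hs)
      simpa only [inv_smul_smul] using this

lemma toC_injective : Function.Injective toC := by
  intro x y h
  induction x using OnePoint.rec <;> induction y using OnePoint.rec
  · rfl
  · exact absurd h (OnePoint.coe_ne_infty _).symm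
  · exact absurd h (OnePoint.coe_ne_infty _)
  · have := OnePoint.coe_injective h
    rw [Complex.ofReal_injective this]

lemma exists_ends (l : Set ℍ) (hl : IsGeodesicLine l) : ∃ ξ η, Ends l ξ η := by
  obtain ⟨γ, ξ, η, hne, hγ, hr, h1, h2⟩ := exists_param l hl
  refine ⟨ξ, η, hne, ⟨γ, hγ, hr, h1⟩, ⟨fun t => γ (-t), ?_, ?_, h2⟩, ?_⟩
  · exact hγ.comp (IsometryEquiv.neg ℝ).isometry
  · rw [← hr]
    exact (Equiv.neg ℝ).surjective.range_comp γ
  · rintro ζ ⟨δ, hδ, hδr, h3⟩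
    have : ∀ t, ∃ u, γ u = δ t := by
      intro t
      have : δ t ∈ Set.range γ := by rw [hr, ← hδr]; exact ⟨t, rfl⟩
      exact this
    choose φ hφ using this
    have hd : ∀ t, 0 ≤ t → φ t = φ 0 + t ∨ φ t = φ 0 - t := by
      intro t ht
      have : dist (φ t) (φ 0) = dist t 0 := by
        rw [← hγ.dist_eq, hφ, hφ, hδ.dist_eq]
      rw [Real.dist_eq, Real.dist_eq, sub_zero, abs_of_nonneg ht] at this
      rcases (abs_eq ht).mp this with h | h
      · left; linarith
      · right; linarith
    have hfreq : (∃ᶠ t in atTop, φ t = φ 0 + t) ∨ (∃ᶠ t in atTop, φ t = φ 0 - t) := by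
      rw [← Filter.frequently_or_distrib]
      apply Filter.Eventually.frequently
      filter_upwards [eventually_ge_atTop 0] with t ht using hd t ht
    rcases hfreq with h | h
    · left
      have h1' : Tendsto (fun t => embH (γ (φ 0 + t))) atTop (𝓝 (toC ξ)) :=
        h1.comp (tendsto_atTop_add_const_left _ _ tendsto_id)
      apply toC_injective
      refine tendsto_nhds_unique_of_frequently_eq h3 h1' ?_
      refine h.mono fun t ht => ?_
      rw [← hφ, ht]
    · right
      have h2' : Tendsto (fun t => embH (γ (-(-φ 0 + t)))) atTop (𝓝 (toC η)) :=
        h2.comp (tendsto_atTop_add_const_left _ _ tendsto_id)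
      apply toC_injective
      refine tendsto_nhds_unique_of_frequently_eq h3 h2' ?_
      refine h.mono fun t ht => ?_
      rw [← hφ, ht]; congr 2; ring

/-! ### The Sanov group -/

/-- The first generator. -/
def Um : SL2 := mk2 1 2 0 1 (by norm_num)

/-- The second generator. -/
def Lm : SL2 := mk2 1 0 2 1 (by norm_num)

/-- The representation `j`. -/
def jj : FreeGroup (Fin 2) →* PSL2 :=
  FreeGroup.lift ![(QuotientGroup.mk Um : PSL2), (QuotientGroup.mk Lm : PSL2)]

lemma mk2_mul (a b c d a' b' c' d' : ℝ) (h : a * d - b * c = 1) (h' : a' * d' - b' * c' = 1)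
    (h'' : (a * a' + b * c') * (c * b' + d * d') - (a * b' + b * d') * (c * a' + d * c') = 1) :
    mk2 a b c d h * mk2 a' b' c' d' h' =
      mk2 (a * a' + b * c') (a * b' + b * d') (c * a' + d * c') (c * b' + d * d') h'' := by
  apply Subtype.ext
  rw [Matrix.SpecialLinearGroup.coe_mul]
  simp [mk2]

lemma mk2_inv (a b c d : ℝ) (h : a * d - b * c = 1) (h' : d * a - (-b) * (-c) = 1) :
    (mk2 a b c d h)⁻¹ = mk2 d (-b) (-c) a h' := by
  rw [inv_eq_iff_mul_eq_one, mk2_mul _ _ _ _ _ _ _ _ _ _ (by nlinarith)]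
  apply Subtype.ext
  simp only [mk2, Matrix.SpecialLinearGroup.coe_one, Matrix.one_fin_two]
  congr 1
  ext i j; fin_cases i <;> fin_cases j <;> simp <;> linarith

lemma mk2_congr {a b c d a' b' c' d' : ℝ} {h : a * d - b * c = 1} {h' : a' * d' - b' * c' = 1}
    (ha : a = a') (hb : b = b') (hc : c = c') (hd : d = d') :
    mk2 a b c d h = mk2 a' b' c' d' h' := by
  subst ha hb hc hd; rfl

lemma jj_U : jj (FreeGroup.of 0) = QuotientGroup.mk Um := by simp [jj]
lemma jj_L : jj (FreeGroup.of 1) = QuotientGroup.mk Lm := by simp [jj]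

/-- Matrices whose class is in the image of `jj`. -/
def rng : Subgroup SL2 := jj.range.comap (QuotientGroup.mk' (Subgroup.center SL2))

lemma mem_rng (A : SL2) : A ∈ rng ↔ ∃ γ, jj γ = QuotientGroup.mk A := Iff.rfl

lemma Um_mem : Um ∈ rng := ⟨_, jj_U⟩
lemma Lm_mem : Lm ∈ rng := ⟨_, jj_L⟩

lemma neg_mem_rng {A : SL2} (h : A ∈ rng) : -A ∈ rng := by
  rw [mem_rng] at *
  obtain ⟨γ, hγ⟩ := h
  refine ⟨γ, ?_⟩
  rw [hγ, mk_eq_iff]; right; simp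

lemma upper_mem (k : ℤ) : mk2 1 (2 * k) 0 1 (by norm_num) ∈ rng := by
  induction k using Int.induction_on with
  | zero =>
    convert rng.one_mem
    apply Subtype.ext
    simp [mk2, Matrix.one_fin_two]
  | succ i ih =>
    convert rng.mul_mem ih Um_mem
    rw [Um, mk2_mul _ _ _ _ _ _ _ _ _ _ (by norm_num)]
    apply mk2_congr <;> push_cast <;> ring
  | pred i ih =>
    convert rng.mul_mem ih (rng.inv_mem Um_mem)
    rw [Um, mk2_inv _ _ _ _ _ (by norm_num), mk2_mul _ _ _ _ _ _ _ _ _ _ (by norm_num)]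
    apply mk2_congr <;> push_cast <;> ring

lemma lower_mem (k : ℤ) : mk2 1 0 (2 * k) 1 (by norm_num) ∈ rng := by
  induction k using Int.induction_on with
  | zero =>
    convert rng.one_mem
    apply Subtype.ext
    simp [mk2, Matrix.one_fin_two]
  | succ i ih =>
    convert rng.mul_mem ih Lm_mem
    rw [Lm, mk2_mul _ _ _ _ _ _ _ _ _ _ (by norm_num)]
    apply mk2_congr <;> push_cast <;> ring
  | pred i ih =>
    convert rng.mul_mem ih (rng.inv_mem Lm_mem)
    rw [Lm, mk2_inv _ _ _ _ _ (by norm_num), mk2_mul _ _ _ _ _ _ _ _ _ _ (by norm_num)]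
    apply mk2_congr <;> push_cast <;> ring

lemma red_aux (a c : ℤ) (h0 : c ≠ 0) (h : |c| < |a|) : ∃ s : ℤ, |a - 2 * s * c| < |a| := by
  rcases abs_cases a with ⟨h1, h2⟩ | ⟨h1, h2⟩ <;> rcases abs_cases c with ⟨h3, h4⟩ | ⟨h3, h4⟩
  · exact ⟨1, by rw [h1]; rw [abs_lt]; constructor <;> omega⟩
  · exact ⟨-1, by rw [h1]; rw [abs_lt]; constructor <;> omega⟩
  · exact ⟨-1, by rw [h1]; rw [abs_lt]; constructor <;> omega⟩
  · exact ⟨1, by rw [h1]; rw [abs_lt]; constructor <;> omega⟩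

lemma gamma_two (n : ℕ) : ∀ (a b c d : ℤ) (h : a * d - b * c = 1), Even b → Even c →
    a.natAbs + c.natAbs ≤ n → mk2 a b c d (by exact_mod_cast h) ∈ rng := by
  induction n with
  | zero =>
    intro a b c d h _ _ hn
    have h1 : a = 0 := by omega
    have h2 : c = 0 := by omega
    simp [h1, h2] at h
  | succ n ih =>
    intro a b c d h hb hc hn
    have ha : Odd a := by
      have : Odd (a * d) := by
        have : a * d = 1 + b * c := by linarith
        rw [this]
        exact odd_one.add_even (hb.mul_right c)
      exact (Int.odd_mul.mp this).1
    by_cases hc0 : c = 0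
    · subst hc0
      obtain ⟨k, rfl⟩ := hb.two_dvd
      have had : a * d = 1 := by linarith
      rcases Int.mul_eq_one_iff_eq_one_or_neg_one.mp had with ⟨rfl, rfl⟩ | ⟨rfl, rfl⟩
      · have e : mk2 ((1 : ℤ) : ℝ) ((2 * k : ℤ) : ℝ) ((0 : ℤ) : ℝ) ((1 : ℤ) : ℝ)
            (by exact_mod_cast h) = mk2 1 (2 * k) 0 1 (by norm_num) := by
          apply mk2_congr <;> push_cast <;> ring
        rw [e]
        exact upper_mem k
      · convert neg_mem_rng (upper_mem (-k))
        apply sl_ext <;> rw [Matrix.SpecialLinearGroup.coe_neg] <;> simp [mk2]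
    · have ha0 : a ≠ 0 := by rintro rfl; simp at ha
      rcases lt_trichotomy |a| |c| with hl | hl | hl
      · obtain ⟨s, hs⟩ := red_aux c a ha0 hl
        have h' : a * (d - 2 * s * b) - b * (c - 2 * s * a) = 1 := by linarith
        have := ih a b (c - 2 * s * a) (d - 2 * s * b) h' hb
          (hc.sub (by rw [mul_assoc]; exact even_two_mul _)) (by
            rw [Int.abs_eq_natAbs, Int.abs_eq_natAbs] at hs; omega)
        convert rng.mul_mem (lower_mem s) this
        rw [mk2_mul _ _ _ _ _ _ _ _ _ _ (by
          have : (a : ℝ) * (d - 2 * s * b) - b * (c - 2 * s * a) = 1 := by exact_mod_cast h'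
          push_cast
          linear_combination this)]
        apply mk2_congr <;> push_cast <;> ring
      · exfalso
        rcases abs_eq_abs.mp hl with rfl | rfl
        · exact (Int.not_even_iff_odd.mpr ha) hc
        · exact (Int.not_even_iff_odd.mpr ha) hc.neg
      · obtain ⟨s, hs⟩ := red_aux a c hc0 hl
        have h' : (a - 2 * s * c) * d - (b - 2 * s * d) * c = 1 := by linarith
        have := ih (a - 2 * s * c) (b - 2 * s * d) c d h'
          (hb.sub (by rw [mul_assoc]; exact even_two_mul _)) hc (by
            rw [Int.abs_eq_natAbs, Int.abs_eq_natAbs] at hs; omega)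
        convert rng.mul_mem (upper_mem s) this
        rw [mk2_mul _ _ _ _ _ _ _ _ _ _ (by
          have : ((a : ℝ) - 2 * s * c) * d - (b - 2 * s * d) * c = 1 := by exact_mod_cast h'
          push_cast
          linear_combination this)]
        apply mk2_congr <;> push_cast <;> ring

lemma tv_mem (k p q : ℤ) : tv (2 * k) ![(p : ℝ), (q : ℝ)] ∈ rng := by
  have := gamma_two _ (1 - 2 * k * p * q) (2 * (k * p ^ 2)) (-(2 * (k * q ^ 2))) (1 + 2 * k * p * q)
    (by ring) (even_two_mul _) (even_two_mul _).neg le_rfl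
  convert this
  apply mk2_congr <;> simp <;> ring

/-! ### Ping-pong -/

/-- Sets defined by the first column. -/
def colSet (P : ℝ → ℝ → Prop) : Set PSL2 := {q | ∃ A : SL2, QuotientGroup.mk A = q ∧ P (A.1 0 0) (A.1 1 0)}

lemma mem_colSet {P : ℝ → ℝ → Prop} (hP : ∀ x y, P (-x) (-y) → P x y) (A : SL2) :
    (QuotientGroup.mk A : PSL2) ∈ colSet P ↔ P (A.1 0 0) (A.1 1 0) := by
  constructor
  · rintro ⟨B, hB, h⟩
    rcases (mk_eq_iff _ _).mp hB with rfl | rfl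
    · exact h
    · apply hP
      simpa using h
  · intro h; exact ⟨A, rfl, h⟩

/-- Ping-pong predicate. -/
def PX0 (x y : ℝ) : Prop := y = 0 ∨ (0 < x * y ∧ y ^ 2 ≤ x ^ 2)
/-- Ping-pong predicate. -/
def PY0 (x y : ℝ) : Prop := x * y < 0 ∧ y ^ 2 < x ^ 2
/-- Ping-pong predicate. -/
def PX1 (x y : ℝ) : Prop := 0 < x * y ∧ x ^ 2 < y ^ 2
/-- Ping-pong predicate. -/
def PY1 (x y : ℝ) : Prop := y ≠ 0 ∧ x * y ≤ 0 ∧ x ^ 2 ≤ y ^ 2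

lemma PX0_neg (x y : ℝ) (h : PX0 (-x) (-y)) : PX0 x y := by simpa [PX0] using h
lemma PY0_neg (x y : ℝ) (h : PY0 (-x) (-y)) : PY0 x y := by simpa [PY0] using h
lemma PX1_neg (x y : ℝ) (h : PX1 (-x) (-y)) : PX1 x y := by simpa [PX1] using h
lemma PY1_neg (x y : ℝ) (h : PY1 (-x) (-y)) : PY1 x y := by simpa [PY1] using h

lemma colSet_disj {P Q : ℝ → ℝ → Prop} (hQ : ∀ x y, Q (-x) (-y) → Q x y)
    (h : ∀ x y, P x y → ¬ Q x y) : Disjoint (colSet P) (colSet Q) := by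
  rw [Set.disjoint_left]
  rintro _ ⟨A, rfl, hA⟩ h2
  rw [mem_colSet hQ] at h2
  exact h _ _ hA h2

lemma smul_colSet {P Q : ℝ → ℝ → Prop} (B : SL2)
    (h : ∀ x y, ¬ P x y → (x ≠ 0 ∨ y ≠ 0) → Q (B.1 0 0 * x + B.1 0 1 * y) (B.1 1 0 * x + B.1 1 1 * y)) :
    (QuotientGroup.mk B : PSL2) • (colSet P)ᶜ ⊆ colSet Q := by
  rintro _ ⟨q, hq, rfl⟩
  obtain ⟨A, rfl⟩ := QuotientGroup.mk_surjective q
  refine ⟨B * A, rfl, ?_⟩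
  have hA : ¬ P (A.1 0 0) (A.1 1 0) := fun hh => hq ⟨A, rfl, hh⟩
  have := h _ _ hA (by
    by_contra hcon
    push Not at hcon
    have := det_eq A
    simp [hcon.1, hcon.2] at this)
  rw [mul_00]
  have e : (B * A).1 1 0 = B.1 1 0 * A.1 0 0 + B.1 1 1 * A.1 1 0 := by
    rw [Matrix.SpecialLinearGroup.coe_mul, Matrix.mul_apply, Fin.sum_univ_two]
  rw [e]
  exact this

lemma pp1 (x y : ℝ) (h : ¬ PY0 x y) : PX0 (x + 2 * y) y := by
  unfold PY0 PX0 at *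
  by_cases hy : y = 0
  · left; exact hy
  right
  have hy2 : 0 < y ^ 2 := by positivity
  by_cases hxy : x * y < 0
  · have h2 : x ^ 2 ≤ y ^ 2 := by by_contra h3; exact h ⟨hxy, lt_of_not_ge h3⟩
    constructor <;> nlinarith [sq_nonneg (x + y)]
  · constructor <;> nlinarith [sq_nonneg (x + y), sq_nonneg x]

lemma pp2 (x y : ℝ) (h : ¬ PX0 x y) : PY0 (x - 2 * y) y := by
  unfold PY0 PX0 at *
  push Not at h
  obtain ⟨hy, h⟩ := h
  have hy2 : 0 < y ^ 2 := by positivity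
  by_cases hxy : 0 < x * y
  · have h2 := h hxy
    have h3 : x * y < y ^ 2 := by nlinarith [sq_nonneg (x - y)]
    constructor <;> nlinarith [sq_nonneg (x - y)]
  · constructor <;> nlinarith [sq_nonneg (x - y), sq_nonneg x]

lemma pp3 (x y : ℝ) (h : ¬ PY1 x y) (h0 : x ≠ 0 ∨ y ≠ 0) : PX1 x (2 * x + y) := by
  unfold PY1 PX1 at *
  by_cases hy : y = 0
  · subst hy
    have hx : x ≠ 0 := by simpa using h0
    have hx2 : 0 < x ^ 2 := by positivity
    constructor <;> nlinarith
  by_cases hxy : x * y ≤ 0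
  · have h2 : y ^ 2 < x ^ 2 := by by_contra h3; exact h ⟨hy, hxy, le_of_not_gt h3⟩
    have hy2 : 0 < y ^ 2 := by positivity
    have h3 : - (x * y) < x ^ 2 := by nlinarith [sq_nonneg (x + y)]
    constructor <;> nlinarith [sq_nonneg (x + y)]
  · push Not at hxy
    constructor <;> nlinarith [sq_nonneg (x + y), sq_nonneg x]

lemma pp4 (x y : ℝ) (h : ¬ PX1 x y) (h0 : x ≠ 0 ∨ y ≠ 0) : PY1 x (y - 2 * x) := by
  unfold PY1 PX1 at *
  by_cases hx : x = 0
  · subst hx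
    have hy : y ≠ 0 := by simpa using h0
    refine ⟨by simpa using hy, by simp, by simp; positivity⟩
  have hx2 : 0 < x ^ 2 := by positivity
  have key : x * y ≤ x ^ 2 := by
    by_cases hxy : 0 < x * y
    · have : y ^ 2 ≤ x ^ 2 := by by_contra h3; exact h ⟨hxy, lt_of_not_ge h3⟩
      nlinarith [sq_nonneg (x - y)]
    · nlinarith
  refine ⟨?_, ?_, ?_⟩
  · intro h3
    have : y = 2 * x := by linarith
    rw [this] at key; nlinarith
  · nlinarith
  · nlinarith [sq_nonneg (x - y)]

lemma Um_inv : Um⁻¹ = mk2 1 (-2) 0 1 (by norm_num) := by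
  rw [Um, mk2_inv _ _ _ _ _ (by norm_num)]; apply mk2_congr <;> simp

lemma Lm_inv : Lm⁻¹ = mk2 1 0 (-2) 1 (by norm_num) := by
  rw [Lm, mk2_inv _ _ _ _ _ (by norm_num)]; apply mk2_congr <;> simp

lemma jj_injective : Function.Injective jj := by
  have dXX : Disjoint (colSet PX0) (colSet PX1) := colSet_disj PX1_neg (by
    rintro x y (rfl | h) h2
    · simp [PX1] at h2
    · exact absurd h2.2 (not_lt.mpr h.2))
  have dYY : Disjoint (colSet PY0) (colSet PY1) := colSet_disj PY1_neg (by
    rintro x y h h2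
    exact absurd h.2 (not_lt.mpr h2.2.2))
  have d00 : Disjoint (colSet PX0) (colSet PY0) := colSet_disj PY0_neg (by
    rintro x y (rfl | h) h2
    · simp [PY0] at h2
    · exact absurd h.1 (not_lt.mpr h2.1.le))
  have d01 : Disjoint (colSet PX0) (colSet PY1) := colSet_disj PY1_neg (by
    rintro x y (rfl | h) h2
    · exact h2.1 rfl
    · exact absurd h.1 (not_lt.mpr h2.2.1))
  have d10 : Disjoint (colSet PX1) (colSet PY0) := colSet_disj PY0_neg (by
    rintro x y h h2
    exact absurd h.1 (not_lt.mpr h2.1.le))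
  have d11 : Disjoint (colSet PX1) (colSet PY1) := colSet_disj PY1_neg (by
    rintro x y h h2
    exact absurd h.1 (not_lt.mpr h2.2.1))
  refine FreeGroup.injective_lift_of_ping_pong
    ![(QuotientGroup.mk Um : PSL2), (QuotientGroup.mk Lm : PSL2)]
    ![colSet PX0, colSet PX1] ![colSet PY0, colSet PY1] ?_ ?_ ?_ ?_ ?_ ?_
  · intro i
    fin_cases i
    · exact ⟨_, 1, rfl, by simp [PX0]⟩
    · exact ⟨_, mk2 1 0 2 1 (by norm_num), rfl, by simp [PX1, mk2]⟩
  · intro i k hik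
    fin_cases i <;> fin_cases k
    · exact absurd rfl hik
    · exact dXX
    · exact dXX.symm
    · exact absurd rfl hik
  · intro i k hik
    fin_cases i <;> fin_cases k
    · exact absurd rfl hik
    · exact dYY
    · exact dYY.symm
    · exact absurd rfl hik
  · intro i k
    fin_cases i <;> fin_cases k
    · exact d00
    · exact d01
    · exact d10
    · exact d11
  · intro i
    fin_cases i
    · refine smul_colSet Um fun x y h h0 => ?_
      simpa [Um, mk2] using pp1 x y h
    · refine smul_colSet Lm fun x y h h0 => ?_
      simpa [Lm, mk2] using pp3 x y h h0
  · intro i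
    fin_cases i
    · change (QuotientGroup.mk (Um⁻¹) : PSL2) • (colSet PX0)ᶜ ⊆ colSet PY0
      rw [Um_inv]
      refine smul_colSet _ fun x y h h0 => ?_
      convert pp2 x y h using 1 <;> simp [mk2]; ring
    · change (QuotientGroup.mk (Lm⁻¹) : PSL2) • (colSet PX1)ᶜ ⊆ colSet PY1
      rw [Lm_inv]
      refine smul_colSet _ fun x y h h0 => ?_
      convert pp4 x y h h0 using 1 <;> simp [mk2]; ring

/-! ### Topology -/

instance sl2_top_group : IsTopologicalGroup SL2 where
  continuous_mul := by
    have h : Continuous fun A : SL2 => (A : Matrix (Fin 2) (Fin 2) ℝ) := continuous_induced_dom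
    refine continuous_induced_rng.mpr ?_
    exact (h.comp continuous_fst).matrix_mul (h.comp continuous_snd)
  continuous_inv := by
    have h : Continuous fun A : SL2 => (A : Matrix (Fin 2) (Fin 2) ℝ) := continuous_induced_dom
    refine continuous_induced_rng.mpr ?_
    exact h.matrix_adjugate

lemma continuous_entry (i k : Fin 2) : Continuous fun A : SL2 => A.1 i k := by
  have h : Continuous fun A : SL2 => (A : Matrix (Fin 2) (Fin 2) ℝ) := continuous_induced_dom
  exact h.matrix_elem i k

/-- The squared norm of a matrix. -/
def nrm (A : SL2) : ℝ := A.1 0 0 ^ 2 + A.1 0 1 ^ 2 + A.1 1 0 ^ 2 + A.1 1 1 ^ 2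

/-- The squared norm on `PSL2`. -/
def nrmP (q : PSL2) : ℝ := nrm (Quotient.out q)

lemma nrmP_mk (A : SL2) : nrmP (QuotientGroup.mk A) = nrm A := by
  unfold nrmP
  rcases out_cases A with h | h <;> rw [h]
  simp [nrm]

lemma continuous_nrmP : Continuous nrmP := by
  rw [(QuotientGroup.isQuotientMap_mk (Subgroup.center SL2)).continuous_iff]
  have : nrmP ∘ (QuotientGroup.mk : SL2 → PSL2) = nrm := funext nrmP_mk
  rw [this]
  unfold nrm
  have h00 := continuous_entry 0 0
  have h01 := continuous_entry 0 1
  have h10 := continuous_entry 1 0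
  have h11 := continuous_entry 1 1
  exact (((h00.pow 2).add (h01.pow 2)).add (h10.pow 2)).add (h11.pow 2)

/-- Integral form of the first generator. -/
def UZ : Matrix.SpecialLinearGroup (Fin 2) ℤ := ⟨!![1, 2; 0, 1], by simp⟩
/-- Integral form of the second generator. -/
def LZ : Matrix.SpecialLinearGroup (Fin 2) ℤ := ⟨!![1, 0; 2, 1], by simp⟩

lemma map_UZ : Matrix.SpecialLinearGroup.map (Int.castRingHom ℝ) UZ = Um := by
  apply Subtype.ext
  rw [Matrix.SpecialLinearGroup.map_apply_coe]
  ext i k; fin_cases i <;> fin_cases k <;> simp [Um, UZ, mk2]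

lemma map_LZ : Matrix.SpecialLinearGroup.map (Int.castRingHom ℝ) LZ = Lm := by
  apply Subtype.ext
  rw [Matrix.SpecialLinearGroup.map_apply_coe]
  ext i k; fin_cases i <;> fin_cases k <;> simp [Lm, LZ, mk2]

lemma jj_integral (γ : FreeGroup (Fin 2)) : ∃ B : Matrix.SpecialLinearGroup (Fin 2) ℤ,
    jj γ = QuotientGroup.mk (Matrix.SpecialLinearGroup.map (Int.castRingHom ℝ) B) := by
  let φ : Matrix.SpecialLinearGroup (Fin 2) ℤ →* PSL2 :=
    (QuotientGroup.mk' (Subgroup.center SL2)).comp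
      (Matrix.SpecialLinearGroup.map (Int.castRingHom ℝ))
  have h : ∀ γ, jj γ ∈ φ.range := by
    intro γ
    induction γ using FreeGroup.induction_on with
    | C1 => rw [map_one]; exact one_mem _
    | of i =>
      fin_cases i
      · refine ⟨UZ, ?_⟩
        refine Eq.trans ?_ jj_U.symm
        exact congrArg QuotientGroup.mk map_UZ
      · refine ⟨LZ, ?_⟩
        refine Eq.trans ?_ jj_L.symm
        exact congrArg QuotientGroup.mk map_LZ
    | inv_of i ih => rw [map_inv]; exact inv_mem ih
    | mul x y hx hy => rw [map_mul]; exact mul_mem hx hy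
  obtain ⟨B, hB⟩ := h γ
  exact ⟨B, hB.symm⟩

lemma sq_le_int {x : ℤ} {C : ℕ} (h : (x : ℝ) ^ 2 ≤ C) : -(C : ℤ) ≤ x ∧ x ≤ C := by
  have h : x ^ 2 ≤ (C : ℤ) := by exact_mod_cast h
  constructor <;> nlinarith

lemma finite_int (C : ℕ) : {B : Matrix.SpecialLinearGroup (Fin 2) ℤ |
    nrm (Matrix.SpecialLinearGroup.map (Int.castRingHom ℝ) B) ≤ C}.Finite := by
  let f : Matrix.SpecialLinearGroup (Fin 2) ℤ → ℤ × ℤ × ℤ × ℤ :=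
    fun B => (B.1 0 0, B.1 0 1, B.1 1 0, B.1 1 1)
  have hf : Function.Injective f := by
    intro B B' h
    simp only [f, Prod.mk.injEq] at h
    obtain ⟨h1, h2, h3, h4⟩ := h
    apply Subtype.ext
    ext i k; fin_cases i <;> fin_cases k <;> assumption
  refine Set.Finite.subset (Set.Finite.preimage hf.injOn
    (Set.finite_Icc ((-C, -C, -C, -C) : ℤ × ℤ × ℤ × ℤ) (C, C, C, C))) ?_
  intro B hB
  simp [nrm] at hB
  have h00 : ((B.1 0 0 : ℤ) : ℝ) ^ 2 ≤ C := by nlinarith [sq_nonneg ((B.1 0 0 : ℤ) : ℝ), sq_nonneg ((B.1 0 1 : ℤ) : ℝ), sq_nonneg ((B.1 1 0 : ℤ) : ℝ), sq_nonneg ((B.1 1 1 : ℤ) : ℝ)]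
  have h01 : ((B.1 0 1 : ℤ) : ℝ) ^ 2 ≤ C := by nlinarith [sq_nonneg ((B.1 0 0 : ℤ) : ℝ), sq_nonneg ((B.1 0 1 : ℤ) : ℝ), sq_nonneg ((B.1 1 0 : ℤ) : ℝ), sq_nonneg ((B.1 1 1 : ℤ) : ℝ)]
  have h10 : ((B.1 1 0 : ℤ) : ℝ) ^ 2 ≤ C := by nlinarith [sq_nonneg ((B.1 0 0 : ℤ) : ℝ), sq_nonneg ((B.1 0 1 : ℤ) : ℝ), sq_nonneg ((B.1 1 0 : ℤ) : ℝ), sq_nonneg ((B.1 1 1 : ℤ) : ℝ)]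
  have h11 : ((B.1 1 1 : ℤ) : ℝ) ^ 2 ≤ C := by nlinarith [sq_nonneg ((B.1 0 0 : ℤ) : ℝ), sq_nonneg ((B.1 0 1 : ℤ) : ℝ), sq_nonneg ((B.1 1 0 : ℤ) : ℝ), sq_nonneg ((B.1 1 1 : ℤ) : ℝ)]
  exact ⟨⟨(sq_le_int h00).1, (sq_le_int h01).1, (sq_le_int h10).1, (sq_le_int h11).1⟩,
    ⟨(sq_le_int h00).2, (sq_le_int h01).2, (sq_le_int h10).2, (sq_le_int h11).2⟩⟩

lemma proper_jj : ProperlyDisc jj (1 : FreeGroup (Fin 2) →* PSL2) := by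
  intro K hK
  have hKK : IsCompact (K⁻¹ * K) := hK.inv.mul hK
  obtain ⟨C, hC⟩ := (hKK.image continuous_nrmP).bddAbove
  obtain ⟨N, hN⟩ := exists_nat_ge C
  have hfin := (finite_int N).image
    (fun B => (QuotientGroup.mk (Matrix.SpecialLinearGroup.map (Int.castRingHom ℝ) B) : PSL2))
  refine (hfin.preimage jj_injective.injOn).subset ?_
  rintro γ ⟨y, ⟨x, hx, hxy⟩, hy⟩
  have hxy' : x * (jj γ)⁻¹ = y := by simpa using hxy
  obtain ⟨B, hB⟩ := jj_integral γ
  refine ⟨B, ?_, hB.symm⟩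
  have hmem : jj γ ∈ K⁻¹ * K := by
    refine ⟨y⁻¹, Set.inv_mem_inv.mpr hy, x, hx, ?_⟩
    rw [← hxy']; simp
  have := hC ⟨_, hmem, rfl⟩
  rw [hB, nrmP_mk] at this
  exact this.trans hN

lemma conn_upper (t : ℝ) : (QuotientGroup.mk (mk2 1 t 0 1 (by norm_num)) : PSL2) ∈
    Subgroup.connectedComponentOfOne PSL2 := by
  let f : ℝ → PSL2 := fun t => QuotientGroup.mk (mk2 1 t 0 1 (by norm_num))
  have hf : Continuous f := by
    refine QuotientGroup.continuous_mk.comp (continuous_induced_rng.mpr ?_)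
    refine continuous_matrix fun i k => ?_
    fin_cases i <;> fin_cases k <;> simp [mk2] <;> fun_prop
  have h1 : f 0 = 1 := by
    change QuotientGroup.mk _ = QuotientGroup.mk 1
    congr 1
    apply Subtype.ext
    simp [mk2, Matrix.one_fin_two]
  exact (isPreconnected_range hf).subset_connectedComponent ⟨0, h1⟩ ⟨t, rfl⟩

lemma conn_lower (t : ℝ) : (QuotientGroup.mk (mk2 1 0 t 1 (by norm_num)) : PSL2) ∈
    Subgroup.connectedComponentOfOne PSL2 := by
  let f : ℝ → PSL2 := fun t => QuotientGroup.mk (mk2 1 0 t 1 (by norm_num))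
  have hf : Continuous f := by
    refine QuotientGroup.continuous_mk.comp (continuous_induced_rng.mpr ?_)
    refine continuous_matrix fun i k => ?_
    fin_cases i <;> fin_cases k <;> simp [mk2] <;> fun_prop
  have h1 : f 0 = 1 := by
    change QuotientGroup.mk _ = QuotientGroup.mk 1
    congr 1
    apply Subtype.ext
    simp [mk2, Matrix.one_fin_two]
  exact (isPreconnected_range hf).subset_connectedComponent ⟨0, h1⟩ ⟨t, rfl⟩

lemma conn_of_ne (A : SL2) (h : A.1 1 0 ≠ 0) : (QuotientGroup.mk A : PSL2) ∈
    Subgroup.connectedComponentOfOne PSL2 := by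
  have hd := det_eq A
  have e : A = mk2 1 ((A.1 0 0 - 1) / A.1 1 0) 0 1 (by norm_num) *
      mk2 1 0 (A.1 1 0) 1 (by norm_num) * mk2 1 ((A.1 1 1 - 1) / A.1 1 0) 0 1 (by norm_num) := by
    have : A.1 0 1 = (A.1 0 0 * A.1 1 1 - 1) / A.1 1 0 := by
      rw [eq_div_iff h]; linarith
    rw [mk2_mul _ _ _ _ _ _ _ _ _ _ (by ring), mk2_mul _ _ _ _ _ _ _ _ _ _ (by ring)]
    apply sl_ext
    · simp only [mk2]; simp; field_simp; ring
    · rw [this]; simp only [mk2]; simp; field_simp; ring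
    · simp [mk2]
    · simp only [mk2]; simp; field_simp; ring
  rw [e]
  exact mul_mem (mul_mem (conn_upper _) (conn_lower _)) (conn_upper _)

lemma conn_all (q : PSL2) : q ∈ Subgroup.connectedComponentOfOne PSL2 := by
  obtain ⟨A, rfl⟩ := QuotientGroup.mk_surjective q
  by_cases h : A.1 1 0 = 0
  · have h0 : A.1 0 0 ≠ 0 := by
      intro h0
      have := det_eq A
      simp [h, h0] at this
    have h1 : (QuotientGroup.mk (mk2 1 0 1 1 (by norm_num) * A) : PSL2) ∈
        Subgroup.connectedComponentOfOne PSL2 := by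
      apply conn_of_ne
      rw [Matrix.SpecialLinearGroup.coe_mul, Matrix.mul_apply, Fin.sum_univ_two]
      simp only [mk2]
      simpa [h] using h0
    exact (Subgroup.mul_mem_cancel_left _ (conn_lower 1)).mp h1
  · exact conn_of_ne A h

lemma conn_comp (x : PSL2) : connectedComponent x = Set.univ := by
  have h : connectedComponent (1 : PSL2) = Set.univ := Set.eq_univ_of_forall conn_all
  rw [← connectedComponent_eq (show x ∈ connectedComponent (1 : PSL2) by rw [h]; trivial)]
  exact h

lemma not_fund : ¬ IsFundDom jj (1 : FreeGroup (Fin 2) →* PSL2) Set.univ := by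
  rintro ⟨-, -, h⟩
  have e : ∀ γ, actImg jj (1 : FreeGroup (Fin 2) →* PSL2) γ Set.univ = Set.univ := by
    intro γ
    refine Set.eq_univ_of_forall fun y => ⟨y * jj γ, trivial, by simp⟩
  have := h (show (1 : FreeGroup (Fin 2)) ≠ FreeGroup.of 0 from (FreeGroup.of_ne_one 0).symm)
  simp only [e, interior_univ] at this
  exact absurd this (by simp)

/-! ### Conclusion -/

lemma wall_contra (D : Set PSL2) (γ : FreeGroup (Fin 2))
    (H : actImg jj (1 : FreeGroup (Fin 2) →* PSL2) 1 D = actImg jj 1 γ D ∨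
      Disjoint (actImg jj (1 : FreeGroup (Fin 2) →* PSL2) 1 D) (actImg jj 1 γ D))
    (x h : PSL2) (hx : x ∈ D) (hx' : x * jj γ ∈ D) (hh : h ∈ D) (hh' : h * jj γ ∉ D) : False := by
  have e : ∀ y, y ∈ actImg jj (1 : FreeGroup (Fin 2) →* PSL2) γ D ↔ y * jj γ ∈ D := by
    intro y
    constructor
    · rintro ⟨z, hz, rfl⟩
      simpa using hz
    · intro hy
      exact ⟨_, hy, by simp⟩
  have e1 : ∀ y, y ∈ actImg jj (1 : FreeGroup (Fin 2) →* PSL2) 1 D ↔ y ∈ D := by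
    intro y
    constructor
    · rintro ⟨z, hz, rfl⟩
      simpa using hz
    · intro hy
      exact ⟨_, hy, by simp⟩
  rcases H with H | H
  · exact hh' ((e h).mp (H ▸ (e1 h).mpr hh))
  · exact Set.disjoint_left.mp H ((e1 x).mpr hx) ((e x).mpr hx')

lemma right_contra (D : Set PSL2) (hD : IsRightCrookedPlane D)
    (H : ∀ γ, actImg jj (1 : FreeGroup (Fin 2) →* PSL2) 1 D = actImg jj 1 γ D ∨
      Disjoint (actImg jj (1 : FreeGroup (Fin 2) →* PSL2) 1 D) (actImg jj 1 γ D)) : False := by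
  obtain ⟨g, l, hl, rfl⟩ := hD
  obtain ⟨ξ, η, hE⟩ := exists_ends l hl
  have hC := right_crk hE
  obtain ⟨k, p, q, hk, hpq, hκ, hle⟩ := exists_int_tv hE.ne
  obtain ⟨γ, hγ⟩ := (mem_rng _).mp (tv_mem k p q)
  have he : (![(p : ℝ), (q : ℝ)] : Fin 2 → ℝ) ≠ 0 := by
    intro h
    have h0 : (p : ℝ) = 0 := by simpa using congrFun h 0
    have h1 : (q : ℝ) = 0 := by simpa using congrFun h 1
    rcases hpq with h' | h'
    · exact h' (by exact_mod_cast h0)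
    · exact h' (by exact_mod_cast h1)
  have hn : (2 * (k : ℝ)) ≠ 0 := by
    have : (k : ℝ) ≠ 0 := by exact_mod_cast hk
    simpa using this
  obtain ⟨M, hM, hM'⟩ := hC.exists_not _ hn _ he
  obtain ⟨X, hX1, hX2⟩ := exists_meet _ _ hC.ne _ hκ
  refine wall_contra _ γ (H γ) (g * QuotientGroup.mk X) (g * QuotientGroup.mk M)
    ⟨_, hC.memA X hX1, rfl⟩ ?_ ⟨_, hM, rfl⟩ ?_
  · rw [hγ, mul_assoc]
    refine ⟨_, ?_, rfl⟩
    refine Or.inr ⟨η, hE.right, X * tv (2 * k) ![(p : ℝ), (q : ℝ)], rfl, _, ?_, hX2⟩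
    rw [abs_div]
    exact div_le_one_of_le₀ hle (abs_nonneg _)
  · rw [hγ, mul_assoc]
    rintro ⟨s, hs, hse⟩
    have : s = QuotientGroup.mk (M * tv (2 * k) ![(p : ℝ), (q : ℝ)]) :=
      mul_left_cancel hse
    exact hM' (this ▸ hs)

lemma left_contra (D : Set PSL2) (hD : IsLeftCrookedPlane D)
    (H : ∀ γ, actImg jj (1 : FreeGroup (Fin 2) →* PSL2) 1 D = actImg jj 1 γ D ∨
      Disjoint (actImg jj (1 : FreeGroup (Fin 2) →* PSL2) 1 D) (actImg jj 1 γ D)) : False := by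
  obtain ⟨g, l, hl, rfl⟩ := hD
  obtain ⟨ξ, η, hE⟩ := exists_ends l hl
  obtain ⟨G, rfl⟩ := QuotientGroup.mk_surjective g
  have hC := left_crk hE
  have hs := hC.ne
  have he0 : (![((1 : ℤ) : ℝ), ((0 : ℤ) : ℝ)] : Fin 2 → ℝ) ≠ 0 := by
    intro h
    have h0 := congrFun h 0
    simp at h0
  set e : Fin 2 → ℝ := ![((1 : ℤ) : ℝ), ((0 : ℤ) : ℝ)] with hedef
  have hf : ap G e ≠ 0 := by
    intro h
    have : ap G⁻¹ (ap G e) = e := by rw [← ap_mul]; simp [ap]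
    rw [h] at this
    apply he0
    rw [← this]
    simp [ap]
  obtain ⟨k, hk, hle⟩ : ∃ k : ℤ, k ≠ 0 ∧ |om (bvec ξ) (bvec η)| ≤
      |om (bvec ξ) (ap (tv (2 * k) (ap G e)) (bvec η))| := by
    simp only [ap_tv, om_add_smul]
    by_cases hsg : 0 ≤ om (bvec ξ) (bvec η) * (om (ap G e) (bvec η) * om (bvec ξ) (ap G e))
    · refine ⟨1, by norm_num, ?_⟩
      rw [← sq_le_sq]
      push_cast
      nlinarith [sq_nonneg (om (ap G e) (bvec η) * om (bvec ξ) (ap G e))]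
    · refine ⟨-1, by norm_num, ?_⟩
      rw [← sq_le_sq]
      push_cast
      nlinarith [sq_nonneg (om (ap G e) (bvec η) * om (bvec ξ) (ap G e))]
  have hκ : om (bvec ξ) (ap (tv (2 * k) (ap G e)) (bvec η)) ≠ 0 := by
    intro h
    rw [h, abs_zero] at hle
    exact hs (abs_nonpos_iff.mp hle)
  obtain ⟨γ, hγ⟩ := (mem_rng _).mp (tv_mem k 1 0)
  have hn : (2 * (k : ℝ)) ≠ 0 := by
    have : (k : ℝ) ≠ 0 := by exact_mod_cast hk
    simpa using this
  have hconj : ∀ Y : SL2, (QuotientGroup.mk Y * QuotientGroup.mk G * jj γ : PSL2) =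
      QuotientGroup.mk (Y * tv (2 * k) (ap G e)) * QuotientGroup.mk G := by
    intro Y
    rw [hγ, ← conj_tv]
    change (QuotientGroup.mk (Y * G * tv (2 * k) e) : PSL2) =
      QuotientGroup.mk (Y * (G * tv (2 * k) e * G⁻¹) * G)
    congr 1
    group
  obtain ⟨M, hM, hM'⟩ := hC.exists_not _ hn _ hf
  obtain ⟨X, hX1, hX2⟩ := exists_meet _ _ hs _ hκ
  refine wall_contra _ γ (H γ) (QuotientGroup.mk X * QuotientGroup.mk G)
    (QuotientGroup.mk M * QuotientGroup.mk G)
    ⟨_, hC.memA X hX1, rfl⟩ ?_ ⟨_, hM, rfl⟩ ?_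
  · rw [hconj]
    refine ⟨_, ?_, rfl⟩
    refine Or.inr ⟨η, hE.right, _, rfl, _, ?_, hX2⟩
    rw [abs_div]
    exact (one_le_div (abs_pos.mpr hs)).mpr hle
  · rw [hconj]
    rintro ⟨s, hs', hse⟩
    have := mul_right_cancel hse
    exact hM' (this ▸ hs')

lemma zero_contra (D : Fin 0 → Set PSL2) (x : PSL2)
    (h : IsFundDom jj (1 : FreeGroup (Fin 2) →* PSL2)
      (closure (connectedComponentIn
        (⋃ (γ : FreeGroup (Fin 2)) (i : Fin 0), actImg jj 1 γ (D i))ᶜ x))) : False := by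
  have e : (⋃ (γ : FreeGroup (Fin 2)) (i : Fin 0),
      actImg jj (1 : FreeGroup (Fin 2) →* PSL2) γ (D i))ᶜ = Set.univ := by simp
  rw [e, connectedComponentIn_univ, conn_comp, closure_univ] at h
  exact not_fund h

theorem stmt0 :
    ∃ r : ℕ, 2 ≤ r ∧ ∃ j ρ : FreeGroup (Fin r) →* PSL2,
      ProperlyDisc j ρ ∧ ¬ AdmitsLeftCrookedFD j ρ ∧ ¬ AdmitsRightCrookedFD j ρ := by
  refine ⟨2, le_rfl, jj, 1, proper_jj, ?_, ?_⟩
  · rintro ⟨m, D, hD, hdis, x, -, hF⟩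
    cases m with
    | zero => exact zero_contra D x hF
    | succ m => exact left_contra (D 0) (hD 0) fun γ => hdis 1 γ 0 0
  · rintro ⟨m, D, hD, hdis, x, -, hF⟩
    cases m with
    | zero => exact zero_contra D x hF
    | succ m => exact right_contra (D 0) (hD 0) fun γ => hdis 1 γ 0 0

end
end

section
/- Let ℓ, ℓ' be geodesic lines of ℍ with endpoints ξ₊, ξ₋ and ξ'₊, ξ'₋ respectively, and let g, g' ∈ PSL(2,ℝ). If the left AdS crooked planes g·C(ℓ) and g'·C(ℓ') are disjoint, then the geodesic lines g·ℓ and g'·ℓ' have disjoint closures in ℍ ∪ ∂∞ℍ; that is, g·ℓ ∩ g'·ℓ' = ∅ and {g·ξ₊, g·ξ₋} ∩ {g'·ξ'₊, g'·ξ'₋} = ∅. -/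
noncomputable section

open Filter Topology Pointwise
open scoped UpperHalfPlane

variable {Γ : Type*} [Group Γ]

open Complex in
lemma rot_exists (y : ℍ) (e : ℂ) (he : ‖e‖ = 1) : ∃ R : SL2, (∀ p q : ℂ,
      ((R 0 0 : ℝ) * p + (R 0 1 : ℝ) * q) - y * ((R 1 0 : ℝ) * p + (R 1 1 : ℝ) * q)
        = e * (p - y * q)) ∧ ∀ p q : ℂ,
      ((R 0 0 : ℝ) * p + (R 0 1 : ℝ) * q)
        - (starRingEnd ℂ) y * ((R 1 0 : ℝ) * p + (R 1 1 : ℝ) * q)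
        = (starRingEnd ℂ) e * (p - (starRingEnd ℂ) y * q) := by
  have hv : y.im ≠ 0 := y.im_ne_zero
  have hvc : (y.im : ℂ) ≠ 0 := by exact_mod_cast hv
  have h1 : e.re ^ 2 + e.im ^ 2 = 1 := by
    have := Complex.sq_norm e
    rw [he, Complex.normSq_apply] at this
    nlinarith
  have hy : (y : ℂ) = y.re + y.im * I := by
    simpa using (Complex.re_add_im (y : ℂ)).symm
  have he' : e = e.re + e.im * I := (Complex.re_add_im e).symm
  refine ⟨⟨!![e.re - e.im * y.re / y.im, e.im * (y.re ^ 2 + y.im ^ 2) / y.im;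
    - e.im / y.im, e.re + e.im * y.re / y.im], ?_⟩, ?_, ?_⟩
  · rw [Matrix.det_fin_two_of]
    field_simp
    linear_combination y.im ^ 2 * h1
  · intro p q
    simp only [Matrix.of_apply, Matrix.cons_val', Matrix.cons_val_zero, Matrix.cons_val_one,
      Matrix.cons_val_fin_one]
    generalize e.re = c at *
    generalize e.im = s at *
    generalize y.re = a at *
    generalize y.im = b at *
    rw [hy, he']
    push_cast
    field_simp
    ring_nf
    simp only [I_sq]
    ring
  · intro p q
    simp only [Matrix.of_apply, Matrix.cons_val', Matrix.cons_val_zero, Matrix.cons_val_one,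
      Matrix.cons_val_fin_one]
    generalize e.re = c at *
    generalize e.im = s at *
    generalize y.re = a at *
    generalize y.im = b at *
    rw [hy, he']
    simp only [map_add, map_mul, conj_ofReal, conj_I]
    push_cast
    field_simp
    ring_nf
    simp only [I_sq]
    ring

lemma sl_smul_eq_iff (A : SL2) (z w : ℍ) :
    A • z = w ↔ ((A 0 0 : ℝ) * z + (A 0 1 : ℝ) : ℂ) = w * ((A 1 0 : ℝ) * z + (A 1 1 : ℝ)) := by
  have hd : ((A 1 0 : ℝ) * z + (A 1 1 : ℝ) : ℂ) ≠ 0 := by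
    exact UpperHalfPlane.denom_ne_zero (A : GL (Fin 2) ℝ) z
  rw [UpperHalfPlane.ext_iff, UpperHalfPlane.coe_specialLinearGroup_apply, div_eq_iff (by simpa using hd)]
  simp

lemma sl_det (A : SL2) : A 0 0 * A 1 1 - A 0 1 * A 1 0 = 1 := by
  have := A.det_coe
  rwa [Matrix.det_fin_two] at this

lemma sl_denom (A : SL2) (z : ℍ) : ((A 1 0 : ℝ) * z + (A 1 1 : ℝ) : ℂ) ≠ 0 := by
  exact UpperHalfPlane.denom_ne_zero (A : GL (Fin 2) ℝ) z

/-- rotation about `y` matching two points -/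
lemma rot_point (y x : ℍ) (B : SL2)
    (h : ‖(((B 0 0 : ℝ) * x + (B 0 1 : ℝ)) - y * ((B 1 0 : ℝ) * x + (B 1 1 : ℝ)) : ℂ)‖
      = ‖(x - y : ℂ)‖) : ∃ R : SL2, R • y = y ∧ R • x = B • x := by
  set p : ℂ := (B 0 0 : ℝ) * x + (B 0 1 : ℝ) with hp
  set q : ℂ := (B 1 0 : ℝ) * x + (B 1 1 : ℝ) with hq
  have hq0 : q ≠ 0 := sl_denom B x
  have hBx : ((B • x : ℍ) : ℂ) = p / q := by
    rw [eq_div_iff hq0]; exact ((sl_smul_eq_iff B x _).1 rfl).symm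
  by_cases hxy : (x : ℂ) - y = 0
  · have : x = y := UpperHalfPlane.ext (sub_eq_zero.1 hxy)
    refine ⟨1, one_smul _ _, ?_⟩
    rw [one_smul]
    rw [hxy, norm_zero, norm_eq_zero, sub_eq_zero] at h
    apply UpperHalfPlane.ext
    rw [hBx, h, mul_div_cancel_right₀ _ hq0, this]
  have hpy : p - y * q ≠ 0 := by
    rw [← norm_ne_zero_iff, h, norm_ne_zero_iff]; exact hxy
  have hxc : (x : ℂ) - (starRingEnd ℂ) y ≠ 0 := by
    intro h0
    have := congrArg Complex.im h0
    simp at this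
    linarith [x.im_pos, y.im_pos]
  have hdet : p * (starRingEnd ℂ) q - (starRingEnd ℂ) p * q = x - (starRingEnd ℂ) x := by
    have := sl_det B
    have h2 : ((B 0 0 : ℝ) * (B 1 1 : ℝ) - (B 0 1 : ℝ) * (B 1 0 : ℝ) : ℂ) = 1 := by exact_mod_cast this
    simp only [hp, hq, map_add, map_mul, Complex.conj_ofReal]
    linear_combination (x - (starRingEnd ℂ) x : ℂ) * h2
  have hsq : (p - y * q) * (starRingEnd ℂ) (p - y * q) = (x - y) * (starRingEnd ℂ) (x - y : ℂ) := by
    rw [Complex.mul_conj, Complex.mul_conj, Complex.normSq_eq_norm_sq, Complex.normSq_eq_norm_sq, h]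
  have hsq2 : (p - (starRingEnd ℂ) y * q) * (starRingEnd ℂ) (p - (starRingEnd ℂ) y * q)
      = (x - (starRingEnd ℂ) y) * (starRingEnd ℂ) (x - (starRingEnd ℂ) y : ℂ) := by
    simp only [map_sub, map_mul, Complex.conj_conj] at hsq ⊢
    linear_combination hsq + ((starRingEnd ℂ) y - y) * hdet
  have hpc : p - (starRingEnd ℂ) y * q ≠ 0 := by
    intro h0
    rw [h0, zero_mul, eq_comm, mul_eq_zero] at hsq2
    rcases hsq2 with h3 | h3
    · exact hxc h3
    · exact hxc ((map_eq_zero _).1 h3)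
  have hn2 : ‖p - (starRingEnd ℂ) y * q‖ = ‖(x - (starRingEnd ℂ) y : ℂ)‖ := by
    rw [Complex.mul_conj, Complex.mul_conj, Complex.normSq_eq_norm_sq,
      Complex.normSq_eq_norm_sq] at hsq2
    have : ‖p - (starRingEnd ℂ) y * q‖ ^ 2 = ‖(x - (starRingEnd ℂ) y : ℂ)‖ ^ 2 := by
      exact_mod_cast hsq2
    exact (sq_eq_sq₀ (norm_nonneg _) (norm_nonneg _)).1 this
  obtain ⟨e, hee⟩ := IsAlgClosed.exists_pow_nat_eq
    ((p - y * q) / (x - y) * ((x - (starRingEnd ℂ) y) / (p - (starRingEnd ℂ) y * q)))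
    (n := 2) (by norm_num)
  have hen : ‖e‖ = 1 := by
    have : ‖e‖ ^ 2 = 1 := by
      rw [← norm_pow, hee, norm_mul, norm_div, norm_div, h, hn2,
        div_self (norm_ne_zero_iff.2 hxy), div_self (norm_ne_zero_iff.2 hxc), one_mul]
    exact (pow_eq_one_iff_of_nonneg (norm_nonneg _) (by norm_num)).1 this
  have hec : e * (starRingEnd ℂ) e = 1 := by
    rw [Complex.mul_conj, Complex.normSq_eq_norm_sq, hen]; simp
  have hy0 : (y : ℂ) - (starRingEnd ℂ) y ≠ 0 := by
    intro h0
    have := congrArg Complex.im h0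
    simp at this
    linarith [y.im_pos]
  obtain ⟨R, hR1, hR2⟩ := rot_exists y e hen
  refine ⟨R, ?_, ?_⟩
  · rw [sl_smul_eq_iff]
    have := hR1 y 1
    simp only [mul_one, sub_self, mul_zero] at this
    exact sub_eq_zero.1 this
  · rw [sl_smul_eq_iff, hBx]
    have h1 := hR1 x 1
    have h2 := hR2 x 1
    simp only [mul_one] at h1 h2
    set P : ℂ := (R 0 0 : ℝ) * x + (R 0 1 : ℝ)
    set Q : ℂ := (R 1 0 : ℝ) * x + (R 1 1 : ℝ)
    have hee' : e * (x - y) * (p - (starRingEnd ℂ) y * q)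
        = (starRingEnd ℂ) e * (x - (starRingEnd ℂ) y) * (p - y * q) := by
      have hmul : e ^ 2 * (x - y) * (p - (starRingEnd ℂ) y * q)
        = (x - (starRingEnd ℂ) y) * (p - y * q) := by
        rw [hee, mul_assoc, mul_comm ((p - y * q) / (x - y)), mul_assoc,
          ← mul_assoc ((p - y * q) / (x - y)), div_mul_cancel₀ _ hxy, mul_comm (p - y * q),
          ← mul_assoc, div_mul_cancel₀ _ hpc]
      linear_combination (starRingEnd ℂ) e * hmul - e * (x - y) * (p - (starRingEnd ℂ) y * q) * hec
    rw [← h1, ← h2] at hee'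
    rw [div_mul_eq_mul_div, eq_div_iff hq0]
    apply mul_left_cancel₀ hy0
    linear_combination hee'

lemma phi_ne (y : ℍ) (w : Fin 2 → ℝ) (hw : w ≠ 0) : ((w 0 : ℝ) - y * (w 1 : ℝ) : ℂ) ≠ 0 := by
  intro h0
  apply hw
  have h1 := congrArg Complex.im h0
  have h2 := congrArg Complex.re h0
  simp [y.im_ne_zero] at h1 h2
  rw [h1] at h2
  ext i; fin_cases i
  · simpa using h2
  · simpa using h1

/-- rotation about `y` matching two real directions -/
lemma rot_vec (y : ℍ) (v w : Fin 2 → ℝ) (hv : v ≠ 0) (hw : w ≠ 0)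
    (h : ‖((w 0 : ℝ) - y * (w 1 : ℝ) : ℂ)‖ ≤ ‖((v 0 : ℝ) - y * (v 1 : ℝ) : ℂ)‖) :
    ∃ R : SL2, R • y = y ∧ ∃ μ : ℝ, 1 ≤ |μ| ∧
      (R : Matrix (Fin 2) (Fin 2) ℝ).mulVec v = μ • w := by
  have hv' := phi_ne y v hv
  have hw' := phi_ne y w hw
  set a : ℂ := (v 0 : ℝ) - y * (v 1 : ℝ) with ha
  set b : ℂ := (w 0 : ℝ) - y * (w 1 : ℝ) with hb
  have hna := norm_ne_zero_iff.2 hv'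
  have hnb := norm_ne_zero_iff.2 hw'
  set m : ℝ := ‖a‖ / ‖b‖ with hm
  obtain ⟨R, hR1, -⟩ := rot_exists y (m * b / a) (by
    rw [norm_div, norm_mul, Complex.norm_real, hm, norm_div, norm_norm, norm_norm]; field_simp)
  refine ⟨R, ?_, m, ?_, ?_⟩
  · rw [sl_smul_eq_iff]
    have := hR1 y 1
    simp only [mul_one, sub_self, mul_zero] at this
    exact sub_eq_zero.1 this
  · rw [hm, abs_of_nonneg (by positivity), le_div_iff₀ (by positivity), one_mul]; exact h
  · have h1 := hR1 (v 0) (v 1)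
    rw [← ha, div_mul_cancel₀ _ hv', hb] at h1
    by_contra hne
    apply phi_ne y _ (sub_ne_zero.2 hne)
    simp only [Pi.sub_apply, Pi.smul_apply, smul_eq_mul, Matrix.mulVec, dotProduct, Fin.sum_univ_two]
    push_cast
    linear_combination h1

lemma pslSMul_mk (A : SL2) (z : ℍ) : pslSMul (QuotientGroup.mk A) z = A • z := by
  unfold pslSMul
  have h : (QuotientGroup.mk (Quotient.out (QuotientGroup.mk A : PSL2)) : PSL2)
      = QuotientGroup.mk A := Quotient.out_eq _
  rw [QuotientGroup.eq, Matrix.SpecialLinearGroup.mem_center_iff] at h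
  set D := Quotient.out (QuotientGroup.mk A : PSL2)
  obtain ⟨r, hr, hr'⟩ := h
  have hA : A = D * (D⁻¹ * A) := by group
  have hz : (D⁻¹ * A) • z = z := by
    rw [sl_smul_eq_iff, ← hr']
    simp [mul_comm]
  conv_rhs => rw [hA]
  rw [mul_smul, hz]

lemma bvec_ne (ξ : OnePoint ℝ) : bvec ξ ≠ 0 := by
  intro h
  cases ξ with
  | infty => have := congrFun h 0; simp [bvec, OnePoint.infty] at this
  | coe r => have := congrFun h 1; simp [bvec, OnePoint.some] at this

lemma emb_infty {f : Filter ℝ} {γ : ℝ → ℍ}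
    (h : Tendsto (fun t => embH (γ t)) f (𝓝 (toC OnePoint.infty))) :
    Tendsto (fun t => ‖(γ t : ℂ)‖) f atTop := by
  rw [toC, OnePoint.map_infty] at h
  have : Tendsto (fun t => (γ t : ℂ)) f (comap ((↑) : ℂ → OnePoint ℂ) (𝓝 OnePoint.infty)) :=
    tendsto_comap_iff.2 h
  rw [OnePoint.comap_coe_nhds_infty, coclosedCompact_eq_cocompact] at this
  exact (tendsto_norm_cocompact_atTop).comp this

lemma emb_coe {f : Filter ℝ} {γ : ℝ → ℍ} {r : ℝ}
    (h : Tendsto (fun t => embH (γ t)) f (𝓝 (toC (r : OnePoint ℝ)))) :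
    Tendsto (fun t => (γ t : ℂ)) f (𝓝 (r : ℂ)) := by
  rw [toC, OnePoint.map_some] at h
  exact OnePoint.isOpenEmbedding_coe.isEmbedding.tendsto_nhds_iff.2 h

/-- limiting inequality for an endpoint -/
lemma lim_ineq (γ : ℝ → ℍ) (y : ℍ) (B : SL2) (ξ : OnePoint ℝ)
    (hξ : Tendsto (fun t => embH (γ t)) atTop (𝓝 (toC ξ)))
    (h : ∀ t, ‖(((B 0 0 : ℝ) * γ t + (B 0 1 : ℝ)) - y * ((B 1 0 : ℝ) * γ t + (B 1 1 : ℝ)) : ℂ)‖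
      ≤ ‖(γ t - y : ℂ)‖) (w : Fin 2 → ℝ)
    (hw : w = (B : Matrix (Fin 2) (Fin 2) ℝ).mulVec (bvec ξ)) :
    ‖((w 0 : ℝ) - y * (w 1 : ℝ) : ℂ)‖ ≤ ‖((bvec ξ 0 : ℝ) - y * (bvec ξ 1 : ℝ) : ℂ)‖ := by
  cases ξ with
  | infty =>
    have hn := emb_infty hξ
    have hinv : Tendsto (fun t => ((γ t : ℂ))⁻¹) atTop (𝓝 0) :=
      tendsto_inv₀_cobounded.comp (tendsto_norm_atTop_iff_cobounded.1 hn)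
    have hL : Tendsto (fun t => ‖(((B 0 0 : ℝ) + (B 0 1 : ℝ) * (γ t : ℂ)⁻¹)
        - y * ((B 1 0 : ℝ) + (B 1 1 : ℝ) * (γ t : ℂ)⁻¹) : ℂ)‖) atTop
        (𝓝 ‖(((B 0 0 : ℝ) + (B 0 1 : ℝ) * 0) - y * ((B 1 0 : ℝ) + (B 1 1 : ℝ) * 0) : ℂ)‖) :=
      (((hinv.const_mul _).const_add _).sub (((hinv.const_mul _).const_add _).const_mul _)).norm
    have hRt : Tendsto (fun t => ‖(1 - y * (γ t : ℂ)⁻¹ : ℂ)‖) atTop (𝓝 ‖(1 - y * 0 : ℂ)‖) :=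
      ((hinv.const_mul _).const_sub _).norm
    have := le_of_tendsto_of_tendsto' hL hRt (fun t => by
      have h0 : (γ t : ℂ) ≠ 0 := (γ t).ne_zero
      have h1 : 0 < ‖(γ t : ℂ)‖ := norm_pos_iff.2 h0
      refine le_of_mul_le_mul_right ?_ h1
      rw [← norm_mul, ← norm_mul]
      have h2 : (γ t : ℂ)⁻¹ * γ t = 1 := inv_mul_cancel₀ h0
      refine le_of_eq_of_le (congrArg norm ?_) ((h t).trans_eq (congrArg norm ?_))
      · linear_combination ((B 0 1 : ℝ) - y * (B 1 1 : ℝ) : ℂ) * h2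
      · linear_combination (y : ℂ) * h2)
    subst hw
    simpa [bvec, OnePoint.infty, Matrix.mulVec, dotProduct, Fin.sum_univ_two] using this
  | coe r =>
    have hn := emb_coe hξ
    have hL : Tendsto (fun t => ‖(((B 0 0 : ℝ) * γ t + (B 0 1 : ℝ))
        - y * ((B 1 0 : ℝ) * γ t + (B 1 1 : ℝ)) : ℂ)‖) atTop
        (𝓝 ‖(((B 0 0 : ℝ) * r + (B 0 1 : ℝ)) - y * ((B 1 0 : ℝ) * r + (B 1 1 : ℝ)) : ℂ)‖) :=
      (((hn.const_mul _).add_const _).sub (((hn.const_mul _).add_const _).const_mul _)).norm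
    have := le_of_tendsto_of_tendsto' hL ((hn.sub_const (y : ℂ)).norm) h
    subst hw
    simpa [bvec, OnePoint.some, Matrix.mulVec, dotProduct, Fin.sum_univ_two] using this

lemma mulVec_ne (B : SL2) (v : Fin 2 → ℝ) (hv : v ≠ 0) :
    (B : Matrix (Fin 2) (Fin 2) ℝ).mulVec v ≠ 0 := by
  intro h
  apply hv
  have : ((B⁻¹ * B : SL2) : Matrix (Fin 2) (Fin 2) ℝ).mulVec v = 0 := by
    rw [Matrix.SpecialLinearGroup.coe_mul, ← Matrix.mulVec_mulVec, h, Matrix.mulVec_zero]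
  simpa using this

/-- Main incompatibility criterion. -/
lemma no_common {l l' : Set ℍ} {G G' : SL2}
    (hdisj : Disjoint (((QuotientGroup.mk G : PSL2) * ·) '' leftCrooked l)
      (((QuotientGroup.mk G' : PSL2) * ·) '' leftCrooked l'))
    (h h' : SL2) (hh : G * h = G' * h')
    (h1 : (QuotientGroup.mk h : PSL2) ∈ leftCrooked l)
    (h2 : (QuotientGroup.mk h' : PSL2) ∈ leftCrooked l') : False := by
  refine Set.disjoint_left.1 hdisj ⟨_, h1, rfl⟩ ⟨_, h2, ?_⟩
  show (QuotientGroup.mk G' : PSL2) * QuotientGroup.mk h' = QuotientGroup.mk G * QuotientGroup.mk h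
  rw [← QuotientGroup.mk_mul, ← QuotientGroup.mk_mul, hh]

lemma no_vec {l l' : Set ℍ} {G G' : SL2}
    (hdisj : Disjoint (((QuotientGroup.mk G : PSL2) * ·) '' leftCrooked l)
      (((QuotientGroup.mk G' : PSL2) * ·) '' leftCrooked l'))
    (y : ℍ) (hy : y ∈ l') (ξ : OnePoint ℝ) (hξ : IsEndpoint l ξ) (w : Fin 2 → ℝ)
    (hw : w = ((G'⁻¹ * G : SL2) : Matrix (Fin 2) (Fin 2) ℝ).mulVec (bvec ξ))
    (h : ‖((w 0 : ℝ) - y * (w 1 : ℝ) : ℂ)‖ ≤ ‖((bvec ξ 0 : ℝ) - y * (bvec ξ 1 : ℝ) : ℂ)‖) :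
    False := by
  obtain ⟨R, hR, μ, hμ, hRv⟩ := rot_vec y (bvec ξ) w (bvec_ne ξ)
    (hw ▸ mulVec_ne _ _ (bvec_ne ξ)) h
  refine no_common hdisj ((G'⁻¹ * G)⁻¹ * R) R (by group) (Or.inr ⟨ξ, hξ, _, rfl, μ, hμ, ?_⟩)
    (Or.inl ⟨y, hy, by rw [pslSMul_mk, hR]⟩)
  rw [Matrix.SpecialLinearGroup.coe_mul, ← Matrix.mulVec_mulVec, hRv, hw, Matrix.mulVec_smul,
    Matrix.mulVec_mulVec, ← Matrix.SpecialLinearGroup.coe_mul, inv_mul_cancel]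
  simp

lemma part_one {l l' : Set ℍ} {G G' : SL2}
    (hdisj : Disjoint (((QuotientGroup.mk G : PSL2) * ·) '' leftCrooked l)
      (((QuotientGroup.mk G' : PSL2) * ·) '' leftCrooked l'))
    (γ : ℝ → ℍ) (hγ : Isometry γ) (hr : Set.range γ = l) (ξ : OnePoint ℝ)
    (hξ : Tendsto (fun t => embH (γ t)) atTop (𝓝 (toC ξ)))
    (x y : ℍ) (hx : x ∈ l) (hy : y ∈ l') (hxy : G • x = G' • y) : False := by
  set B := G'⁻¹ * G with hB
  have hBx : B • x = y := by rw [hB, mul_smul, hxy, inv_smul_smul]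
  obtain ⟨t0, rfl⟩ : ∃ t, γ t = x := by rw [← hr] at hx; exact hx
  set F : ℝ → ℝ := fun t =>
    ‖(((B 0 0 : ℝ) * γ t + (B 0 1 : ℝ)) - y * ((B 1 0 : ℝ) * γ t + (B 1 1 : ℝ)) : ℂ)‖
      - ‖(γ t - y : ℂ)‖ with hF
  have hc : Continuous (fun t => (γ t : ℂ)) := UpperHalfPlane.continuous_coe.comp hγ.continuous
  have hFc : Continuous F := by
    rw [hF]; fun_prop
  by_cases hz : ∃ t, F t = 0
  · obtain ⟨t, ht⟩ := hz
    obtain ⟨R, hR1, hR2⟩ := rot_point y (γ t) B (sub_eq_zero.1 ht)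
    refine no_common hdisj (B⁻¹ * R) R (by rw [hB]; group)
      (Or.inl ⟨γ t, hr ▸ ⟨t, rfl⟩, ?_⟩) (Or.inl ⟨y, hy, by rw [pslSMul_mk, hR1]⟩)
    rw [pslSMul_mk, mul_smul, hR2, inv_smul_smul]
  · have h0 : F t0 ≤ 0 := by
      have := sub_eq_zero.2 ((sl_smul_eq_iff B (γ t0) y).1 hBx)
      simp only [hF]
      rw [this, norm_zero]
      linarith [norm_nonneg (γ t0 - y : ℂ)]
    have hall : ∀ t, F t ≤ 0 := by
      intro t
      by_contra hpos
      exact hz (mem_range_of_exists_le_of_exists_ge hFc ⟨t0, h0⟩ ⟨t, (not_le.1 hpos).le⟩)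
    exact no_vec hdisj y hy ξ ⟨γ, hγ, hr, hξ⟩ _ rfl
      (lim_ineq γ y B ξ hξ (fun t => sub_nonpos.1 (hall t)) _ rfl)

lemma eig_exists (ξ : OnePoint ℝ) (μ : ℝ) (hμ : μ ≠ 0) : ∃ A : SL2,
    (A : Matrix (Fin 2) (Fin 2) ℝ).mulVec (bvec ξ) = μ • bvec ξ := by
  cases ξ with
  | infty =>
    refine ⟨⟨!![μ, 0; 0, μ⁻¹], by simp [Matrix.det_fin_two_of, hμ]⟩, ?_⟩
    ext i; fin_cases i <;> simp [bvec, OnePoint.infty, Matrix.mulVec, dotProduct, Fin.sum_univ_two]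
  | coe r =>
    refine ⟨⟨!![μ⁻¹, r * (μ - μ⁻¹); 0, μ], by simp [Matrix.det_fin_two_of, hμ]⟩, ?_⟩
    ext i; fin_cases i <;> simp [bvec, OnePoint.some, Matrix.mulVec, dotProduct, Fin.sum_univ_two]
    ring

lemma bd_vec (g : PSL2) (ξ : OnePoint ℝ) : ∃ κ : ℝ, κ ≠ 0 ∧
    ((Quotient.out g : SL2) : Matrix (Fin 2) (Fin 2) ℝ).mulVec (bvec ξ)
      = κ • bvec (bdSMul g ξ) := by
  have hne := mulVec_ne (Quotient.out g : SL2) _ (bvec_ne ξ)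
  unfold bdSMul
  set w := ((Quotient.out g : SL2) : Matrix (Fin 2) (Fin 2) ℝ).mulVec (bvec ξ) with hw
  by_cases h : w 1 = 0
  · refine ⟨w 0, ?_, ?_⟩
    · intro h0; apply hne; ext i; fin_cases i <;> simp [h0, h]
    · simp only [h, if_true]
      ext i; fin_cases i <;> simp [bvec, OnePoint.infty, h]
  · refine ⟨w 1, h, ?_⟩
    simp only [h, if_false]
    ext i; fin_cases i <;> simp [bvec, OnePoint.some]
    field_simp

lemma part_two {l l' : Set ℍ} {G G' : SL2}
    (hdisj : Disjoint (((QuotientGroup.mk G : PSL2) * ·) '' leftCrooked l)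
      (((QuotientGroup.mk G' : PSL2) * ·) '' leftCrooked l'))
    (ξ ξ' : OnePoint ℝ) (hξ : IsEndpoint l ξ) (hξ' : IsEndpoint l' ξ') (κ : ℝ) (hκ : κ ≠ 0)
    (hv : ((G'⁻¹ * G : SL2) : Matrix (Fin 2) (Fin 2) ℝ).mulVec (bvec ξ) = κ • bvec ξ') : False := by
  by_cases he : ξ = ξ'
  · subst he
    obtain ⟨A, hA⟩ := eig_exists ξ (|κ| + 1) (by positivity)
    have hκ' : 0 < |κ| := abs_pos.2 hκ
    refine no_common hdisj ((G'⁻¹ * G)⁻¹ * A) A (by group)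
      (Or.inr ⟨ξ, hξ, _, rfl, (|κ| + 1) * κ⁻¹, ?_, ?_⟩)
      (Or.inr ⟨ξ, hξ', _, rfl, |κ| + 1, ?_, hA⟩)
    · rw [abs_mul, abs_inv, abs_of_pos (by positivity : 0 < |κ| + 1), ← div_eq_mul_inv,
        le_div_iff₀ hκ']
      linarith
    · have : bvec ξ = κ⁻¹ • ((G'⁻¹ * G : SL2) : Matrix (Fin 2) (Fin 2) ℝ).mulVec (bvec ξ) := by
        rw [hv, smul_smul, inv_mul_cancel₀ hκ, one_smul]
      rw [Matrix.SpecialLinearGroup.coe_mul, ← Matrix.mulVec_mulVec, hA, Matrix.mulVec_smul]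
      conv_lhs => rw [this]
      rw [Matrix.mulVec_smul, Matrix.mulVec_mulVec, ← Matrix.SpecialLinearGroup.coe_mul,
        inv_mul_cancel, smul_smul]
      simp
    · rw [abs_of_pos (by positivity : 0 < |κ| + 1)]; linarith
  · obtain ⟨γ, hγ, hr, ht⟩ := hξ'
    have key : ∃ t, ‖(((κ • bvec ξ') 0 : ℝ) - γ t * ((κ • bvec ξ') 1 : ℝ) : ℂ)‖
        ≤ ‖((bvec ξ 0 : ℝ) - γ t * (bvec ξ 1 : ℝ) : ℂ)‖ := by
      cases ξ' with
      | infty =>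
        cases ξ with
        | infty => exact absurd rfl he
        | coe r =>
          obtain ⟨t, ht⟩ := ((emb_infty ht).eventually_ge_atTop (|κ| + |r|)).exists
          refine ⟨t, ?_⟩
          have h3 := norm_sub_norm_le (γ t : ℂ) (r : ℂ)
          rw [Complex.norm_real, Real.norm_eq_abs, norm_sub_rev] at h3
          simp [bvec, OnePoint.infty, OnePoint.some]
          linarith
      | coe s =>
        have hn := emb_coe ht
        have hL : Tendsto (fun t => ‖(((κ • bvec (s : OnePoint ℝ)) 0 : ℝ)
            - γ t * ((κ • bvec (s : OnePoint ℝ)) 1 : ℝ) : ℂ)‖) atTop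
            (𝓝 ‖(((κ • bvec (s : OnePoint ℝ)) 0 : ℝ)
            - s * ((κ • bvec (s : OnePoint ℝ)) 1 : ℝ) : ℂ)‖) :=
          ((hn.mul_const _).const_sub _).norm
        have hR : Tendsto (fun t => ‖((bvec ξ 0 : ℝ) - γ t * (bvec ξ 1 : ℝ) : ℂ)‖) atTop
            (𝓝 ‖((bvec ξ 0 : ℝ) - s * (bvec ξ 1 : ℝ) : ℂ)‖) :=
          ((hn.mul_const _).const_sub _).norm
        have hlt : ‖(((κ • bvec (s : OnePoint ℝ)) 0 : ℝ)
            - s * ((κ • bvec (s : OnePoint ℝ)) 1 : ℝ) : ℂ)‖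
            < ‖((bvec ξ 0 : ℝ) - s * (bvec ξ 1 : ℝ) : ℂ)‖ := by
          have h0 : (((κ • bvec (s : OnePoint ℝ)) 0 : ℝ)
            - s * ((κ • bvec (s : OnePoint ℝ)) 1 : ℝ) : ℂ) = 0 := by
            simp [bvec, OnePoint.some]; ring
          rw [h0, norm_zero, norm_pos_iff]
          cases ξ with
          | infty => simp [bvec, OnePoint.infty]
          | coe r =>
            have : r ≠ s := fun h => he (by rw [h])
            simp only [bvec, Option.elim, Matrix.cons_val_zero, Matrix.cons_val_one, Complex.ofReal_one]
            intro h4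
            apply this
            have : (r : ℂ) = s := by linear_combination h4
            exact_mod_cast this
        obtain ⟨t, ht⟩ := (hL.eventually_lt hR hlt).exists
        exact ⟨t, ht.le⟩
    obtain ⟨t, ht⟩ := key
    exact no_vec hdisj (γ t) (hr ▸ ⟨t, rfl⟩) ξ hξ _ hv.symm ht

lemma endpoint_neg {γ : ℝ → ℍ} {l : Set ℍ} {ξ : OnePoint ℝ} (hγ : Isometry γ)
    (hr : Set.range γ = l) (h : Tendsto (fun t => embH (γ t)) atBot (𝓝 (toC ξ))) :
    IsEndpoint l ξ := by
  refine ⟨fun t => γ (-t), hγ.comp (IsometryEquiv.neg ℝ).isometry, ?_, h.comp tendsto_neg_atTop_atBot⟩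
  rw [← hr]
  exact (Equiv.neg ℝ).surjective.range_comp γ

theorem stmt2 (γ γ' : ℝ → ℍ) (hγ : Isometry γ) (hγ' : Isometry γ')
    (l l' : Set ℍ) (hrange : Set.range γ = l) (hrange' : Set.range γ' = l')
    (ξp ξm ξ'p ξ'm : OnePoint ℝ)
    (hξp : Tendsto (fun t => embH (γ t)) atTop (𝓝 (toC ξp)))
    (hξm : Tendsto (fun t => embH (γ t)) atBot (𝓝 (toC ξm)))
    (hξ'p : Tendsto (fun t => embH (γ' t)) atTop (𝓝 (toC ξ'p)))
    (hξ'm : Tendsto (fun t => embH (γ' t)) atBot (𝓝 (toC ξ'm)))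
    (g g' : PSL2)
    (hdisj : Disjoint ((g * ·) '' leftCrooked l) ((g' * ·) '' leftCrooked l')) :
    pslImg g l ∩ pslImg g' l' = ∅ ∧
      ({bdSMul g ξp, bdSMul g ξm} ∩ {bdSMul g' ξ'p, bdSMul g' ξ'm} : Set (OnePoint ℝ)) = ∅ := by
  have hg : (QuotientGroup.mk (Quotient.out g) : PSL2) = g := Quotient.out_eq g
  have hg' : (QuotientGroup.mk (Quotient.out g') : PSL2) = g' := Quotient.out_eq g'
  have hd : Disjoint (((QuotientGroup.mk (Quotient.out g) : PSL2) * ·) '' leftCrooked l)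
      (((QuotientGroup.mk (Quotient.out g') : PSL2) * ·) '' leftCrooked l') := by
    rw [hg, hg']; exact hdisj
  constructor
  · rw [Set.eq_empty_iff_forall_notMem]
    rintro z ⟨⟨x, hx, hxz⟩, ⟨y, hy, hyz⟩⟩
    exact part_one hd γ hγ hrange ξp hξp x y hx hy (hxz.trans hyz.symm)
  · have main : ∀ ξ ξ', IsEndpoint l ξ → IsEndpoint l' ξ' → bdSMul g ξ ≠ bdSMul g' ξ' := by
      intro ξ ξ' h h' heq
      obtain ⟨a, ha, hav⟩ := bd_vec g ξ
      obtain ⟨b, hb, hbv⟩ := bd_vec g' ξ'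
      refine part_two hd ξ ξ' h h' (a * b⁻¹) (by positivity) ?_
      have h5 : bvec (bdSMul g' ξ') = b⁻¹ • ((Quotient.out g' : SL2) :
          Matrix (Fin 2) (Fin 2) ℝ).mulVec (bvec ξ') := by
        rw [hbv, smul_smul, inv_mul_cancel₀ hb, one_smul]
      rw [Matrix.SpecialLinearGroup.coe_mul, ← Matrix.mulVec_mulVec, hav, heq, h5,
        Matrix.mulVec_smul, Matrix.mulVec_smul, Matrix.mulVec_mulVec,
        ← Matrix.SpecialLinearGroup.coe_mul, inv_mul_cancel, smul_smul]
      simp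
    have e1 : IsEndpoint l ξp := ⟨γ, hγ, hrange, hξp⟩
    have e2 : IsEndpoint l ξm := endpoint_neg hγ hrange hξm
    have e3 : IsEndpoint l' ξ'p := ⟨γ', hγ', hrange', hξ'p⟩
    have e4 : IsEndpoint l' ξ'm := endpoint_neg hγ' hrange' hξ'm
    rw [Set.eq_empty_iff_forall_notMem]
    rintro z ⟨h1, h2⟩
    simp only [Set.mem_insert_iff, Set.mem_singleton_iff] at h1 h2
    rcases h1 with h1 | h1 <;> rcases h2 with h2 | h2
    · exact main _ _ e1 e3 (h1.symm.trans h2)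
    · exact main _ _ e1 e4 (h1.symm.trans h2)
    · exact main _ _ e2 e3 (h1.symm.trans h2)
    · exact main _ _ e2 e4 (h1.symm.trans h2)

end
end
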